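/- arXiv:2301.02752 — 9 statements merged into one kernel-verified Lean document; each statement's English description precedes it below -/
import Mathlib

section
/- A nilpotent group is a strong retract if and only if it is abelian and is either a divisible group, or a group of bounded period that decomposes into a direct sum of primary cyclic groups in which the orders of any two distinct direct summands are either equal or coprime (i.e., it is isomorphic to a direct sum ⊕_{i=1}^m C_{p_i^{k_i}}(n_i), where p_1,…,p_m are distinct primes, k_i ∈ ℕ, n_i are cardinal numbers, and C_{p^k}(n) denotes the direct sum of n copies of ℤ/p^kℤ). -/
universe u

/-- `K` belongs to the variety generated by `H`: every identity (word in a free group)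
that holds identically in `H` also holds identically in `K`. -/
def InVarietyOf (H : Type u) [Group H] (K : Type u) [Group K] : Prop :=
  ∀ (n : ℕ) (w : FreeGroup (Fin n)),
    (∀ f : Fin n → H, FreeGroup.lift f w = 1) →
    ∀ f : Fin n → K, FreeGroup.lift f w = 1

/-- `H` is a strong retract: for every group `G` in the variety generated by `H`
containing `H` (via an injective homomorphism `ι`), there is a retraction of `G`
onto (the copy of) `H`. -/
def IsStrongRetract (H : Type u) [Group H] : Prop :=
  ∀ (G : Type u) [Group G], ∀ ι : H →* G, Function.Injective ι →
    InVarietyOf H G → ∃ ρ : G →* H, ∀ h : H, ρ (ι h) = h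


namespace InVarietyOf

theorem mul_comm {H K : Type u} [Group H] [Group K] (hK : InVarietyOf H K)
    (hH : ∀ a b : H, a * b = b * a) (a b : K) : a * b = b * a := by
  have := hK 2 (.of 0 * .of 1 * (.of 0)⁻¹ * (.of 1)⁻¹) (fun f ↦ by simp [hH (f 0) (f 1)]) ![a, b]
  simpa [mul_inv_eq_iff_eq_mul] using this

theorem pow_eq_one {H K : Type u} [Group H] [Group K] (hK : InVarietyOf H K) {N : ℕ}
    (hH : ∀ h : H, h ^ N = 1) (k : K) : k ^ N = 1 := by
  simpa using hK 1 (.of 0 ^ N) (fun f ↦ by simp [hH]) fun _ ↦ k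

theorem prod_self (H : Type u) [Group H] : InVarietyOf H (H × H) := fun n w hw f ↦ by
  have h₁ := FreeGroup.lift_unique (f := fun i ↦ (f i).1)
    ((MonoidHom.fst H H).comp (FreeGroup.lift f)) (by simp) (x := w)
  have h₂ := FreeGroup.lift_unique (f := fun i ↦ (f i).2)
    ((MonoidHom.snd H H).comp (FreeGroup.lift f)) (by simp) (x := w)
  exact Prod.ext (h₁.trans (hw _)) (h₂.trans (hw _))

theorem of_surjective {H K L : Type u} [Group H] [Group K] [Group L] (hK : InVarietyOf H K)
    (φ : K →* L) (hφ : Function.Surjective φ) : InVarietyOf H L := fun n w hw f ↦ by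
  choose g hg using fun i ↦ hφ (f i)
  have := FreeGroup.lift_unique (f := f) (φ.comp (FreeGroup.lift g)) (by simp [hg]) (x := w)
  simpa [hK n w hw g] using this.symm

end InVarietyOf

/-- The exponent sum of the `i`-th generator in a word. -/
def FreeGroup.exponentSum {n : ℕ} (i : Fin n) : FreeGroup (Fin n) →* Multiplicative ℤ :=
  FreeGroup.lift (Pi.mulSingle i (.ofAdd 1))

theorem FreeGroup.lift_eq_prod_zpow_exponentSum {n : ℕ} {A : Type*} [CommGroup A] (f : Fin n → A)
    (w : FreeGroup (Fin n)) :
    FreeGroup.lift f w = ∏ i, f i ^ (FreeGroup.exponentSum i w).toAdd := by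
  have : FreeGroup.lift f = ∏ i, (zpowersHom A (f i)).comp (FreeGroup.exponentSum i) := by
    ext j
    rw [MonoidHom.finsetProd_apply, Finset.prod_eq_single j]
    · simp [FreeGroup.exponentSum]
    · intro i _ hij
      simp [FreeGroup.exponentSum, Pi.mulSingle_eq_of_ne hij.symm]
    · simp
  rw [this, MonoidHom.finsetProd_apply]
  simp

/-- An abelian group belongs to the variety of an abelian group `H` as soon as it is killed by the
exponent of `H` (which is `0` when `H` has unbounded period). -/
theorem InVarietyOf.of_pow_exponent {H K : Type u} [CommGroup H] [CommGroup K]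
    (hK : ∀ k : K, k ^ Monoid.exponent H = 1) : InVarietyOf H K := fun n w hw f ↦ by
  have hK' : Monoid.exponent K ∣ Monoid.exponent H := Monoid.exponent_dvd_of_forall_pow_eq_one hK
  rw [FreeGroup.lift_eq_prod_zpow_exponentSum]
  refine Finset.prod_eq_one fun i _ ↦ ?_
  refine Group.exponent_dvd_iff_forall_zpow_eq_one.1
    ((Int.natCast_dvd_natCast.2 hK').trans ?_) (f i)
  refine Group.exponent_dvd_iff_forall_zpow_eq_one.2 fun h ↦ ?_
  have := hw (Pi.mulSingle i h)
  rw [FreeGroup.lift_eq_prod_zpow_exponentSum, Finset.prod_eq_single i] at this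
  · simpa using this
  · intro j _ hij
    simp [Pi.mulSingle_eq_of_ne hij]
  · simp

/-- Retract the central product of two copies of `H` onto the first one: the second copy is then
mapped to the center, by a map fixing the center. -/
theorem IsStrongRetract.commutator_inf_center_eq_bot {H : Type u} [Group H]
    (hH : IsStrongRetract H) : commutator H ⊓ Subgroup.center H = ⊥ := by
  let N : Subgroup (H × H) :=
    { carrier := {x | x.1 ∈ Subgroup.center H ∧ x.2 = x.1⁻¹}
      one_mem' := by simp
      mul_mem' := by
        rintro ⟨a, b⟩ ⟨c, d⟩ ⟨ha, hb⟩ ⟨hc, hd⟩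
        dsimp at ha hb hc hd ⊢
        subst hb hd
        refine ⟨mul_mem ha hc, (mul_inv_rev a c).symm ▸ ?_⟩
        exact Subgroup.mem_center_iff.1 (inv_mem hc) _
      inv_mem' := by
        rintro ⟨a, b⟩ ⟨ha, hb⟩
        exact ⟨inv_mem ha, congrArg _ hb⟩ }
  have hN : N.Normal := ⟨by
    rintro ⟨a, b⟩ ⟨ha, hb⟩ ⟨c, d⟩
    dsimp at ha hb
    subst hb
    have h₁ : c * a * c⁻¹ = a := by rw [Subgroup.mem_center_iff.1 ha c]; simp
    have h₂ : d * a⁻¹ * d⁻¹ = a⁻¹ := by rw [Subgroup.mem_center_iff.1 (inv_mem ha) d]; simp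
    exact ⟨by simpa [h₁] using ha, by simp [h₁, h₂]⟩⟩
  let π := QuotientGroup.mk' N
  obtain ⟨ρ, hρ⟩ := hH ((H × H) ⧸ N) (π.comp (MonoidHom.inl H H))
    ((injective_iff_map_eq_one _).2 fun h hh ↦ by
      have : ((h, 1) : H × H) ∈ N := (QuotientGroup.eq_one_iff _).1 hh
      simpa using this.2.symm)
    ((InVarietyOf.prod_self H).of_surjective π (QuotientGroup.mk'_surjective N))
  let σ : H →* H := (ρ.comp π).comp (MonoidHom.inr H H)
  have hσ (a b : H) : a * σ b = σ b * a := by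
    conv_lhs => rw [← hρ a]
    conv_rhs => rw [← hρ a]
    simp only [σ, MonoidHom.comp_apply, ← map_mul]
    simp
  have hσ_center (z : H) (hz : z ∈ Subgroup.center H) : σ z = z := by
    conv_rhs => rw [← hρ z]
    simp only [σ, MonoidHom.comp_apply]
    congr 1
    exact QuotientGroup.eq.2 ⟨by simpa using hz, by simp⟩
  have hσ_comm : commutator H ≤ σ.ker := by
    refine Subgroup.commutator_le.2 fun a _ b _ ↦ ?_
    rw [MonoidHom.mem_ker, map_commutatorElement, commutatorElement_eq_one_iff_mul_comm]
    exact hσ _ _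
  refine eq_bot_iff.2 fun z hz ↦ ?_
  rw [Subgroup.mem_bot, ← hσ_center z hz.2]
  exact hσ_comm hz.1

theorem Group.mul_comm_of_commutator_inf_center {H : Type*} [Group H] [Group.IsNilpotent H]
    (hH : commutator H ⊓ Subgroup.center H = ⊥) (a b : H) : a * b = b * a := by
  have step (n : ℕ) (hn : (⊤ : Subgroup H).lowerCentralSeries (n + 2) = ⊥) :
      (⊤ : Subgroup H).lowerCentralSeries (n + 1) = ⊥ := by
    rw [Subgroup.lowerCentralSeries_succ, Subgroup.commutator_eq_bot_iff_le_centralizer,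
      Subgroup.coe_top, Subgroup.centralizer_univ] at hn
    refine eq_bot_iff.2 (hH ▸ le_inf ?_ hn)
    exact Subgroup.lowerCentralSeries_antitone _ (by omega : 1 ≤ n + 1)
  obtain ⟨n, hn⟩ :=
    Subgroup.nilpotent_iff_lowerCentralSeries.1 ‹Group.IsNilpotent H›
  have h (n : ℕ) : (⊤ : Subgroup H).lowerCentralSeries (n + 1) = ⊥ →
      (⊤ : Subgroup H).lowerCentralSeries 1 = ⊥ := by
    induction n with
    | zero => exact id
    | succ n ih => exact fun h ↦ ih (step n h)
  have hcomm : commutator H = ⊥ :=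
    h n (eq_bot_iff.2 (hn ▸ Subgroup.lowerCentralSeries_antitone _ n.le_succ))
  rw [← commutatorElement_eq_one_iff_mul_comm, ← Subgroup.mem_bot, ← hcomm]
  exact Subgroup.commutator_mem_commutator (Subgroup.mem_top a) (Subgroup.mem_top b)

/-- `z` is a multiple of `a` as soon as it is killed by every integer `k` such that `k * a` is
divisible by `N`. For `N`-torsion groups this is injectivity over `ZMod N`. -/
def HasRootsMod (N : ℕ) (A : Type*) [AddCommGroup A] : Prop :=
  ∀ (a : ℤ) (z : A), (∀ k : ℤ, (N : ℤ) ∣ k * a → k • z = 0) → ∃ x, a • x = z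

namespace HasRootsMod

theorem of_addEquiv {N : ℕ} {A B : Type*} [AddCommGroup A] [AddCommGroup B]
    (hA : HasRootsMod N A) (e : A ≃+ B) : HasRootsMod N B := fun a z hz ↦ by
  obtain ⟨x, hx⟩ := hA a (e.symm z) fun k hk ↦ by rw [← map_zsmul, hz k hk, map_zero]
  exact ⟨e x, by rw [← map_zsmul, hx, e.apply_symm_apply]⟩

theorem of_divisible (N : ℕ) {A : Type*} [AddCommGroup A]
    (hA : ∀ (z : A) (n : ℕ), 1 ≤ n → ∃ x : A, n • x = z) : HasRootsMod N A := fun a z hz ↦ by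
  rcases eq_or_ne a 0 with rfl | ha
  · exact ⟨0, by simpa using (hz 1 (by simp)).symm⟩
  · obtain ⟨x, hx⟩ := hA z a.natAbs (by omega)
    obtain h | h := Int.natAbs_eq a
    · exact ⟨x, by rw [h, natCast_zsmul, hx]⟩
    · exact ⟨-x, by rw [h, neg_smul_neg, natCast_zsmul, hx]⟩

theorem baer {N : ℕ} {A : Type*} [AddCommGroup A] [Module (ZMod N) A] (hA : HasRootsMod N A) :
    Module.Baer (ZMod N) A := fun I g ↦ by
  have : IsPrincipalIdealRing (ZMod N) :=
    .of_surjective (Int.castRingHom (ZMod N)) ZMod.intCast_surjective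
  obtain ⟨d, rfl⟩ := (IsPrincipalIdealRing.principal I).principal
  obtain ⟨a, rfl⟩ := ZMod.intCast_surjective d
  have ha : (a : ZMod N) ∈ Submodule.span (ZMod N) {(a : ZMod N)} :=
    Submodule.mem_span_singleton_self _
  obtain ⟨x, hx⟩ := hA a (g ⟨a, ha⟩) fun k hk ↦ by
    rw [← map_zsmul, ← map_zero g]
    congr 1
    ext
    simpa using (ZMod.intCast_zmod_eq_zero_iff_dvd _ _).2 hk
  refine ⟨LinearMap.toSpanSingleton _ _ x, fun y hy ↦ ?_⟩
  obtain ⟨c, rfl⟩ := Submodule.mem_span_singleton.1 hy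
  have : (⟨c • (a : ZMod N), hy⟩ : Submodule.span (ZMod N) {(a : ZMod N)}) = c • ⟨a, ha⟩ := rfl
  rw [this, map_smul, map_smul, ← hx, LinearMap.toSpanSingleton_apply, Int.cast_smul_eq_zsmul]

theorem finsupp {N : ℕ} {A ι : Type*} [AddCommGroup A] (hA : HasRootsMod N A) :
    HasRootsMod N (ι →₀ A) := fun a z hz ↦ by
  change z ∈ (zsmulAddGroupHom a : (ι →₀ A) →+ _).range
  rw [← z.sum_single]
  refine AddSubgroup.sum_mem _ fun i _ ↦ ?_
  obtain ⟨x, hx⟩ := hA a (z i) fun k hk ↦ by rw [← Finsupp.smul_apply, hz k hk, Finsupp.zero_apply]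
  exact ⟨Finsupp.single i x, by simp [hx]⟩

theorem directSum {N : ℕ} {ι : Type*} {A : ι → Type*} [∀ i, AddCommGroup (A i)]
    (hA : ∀ i, HasRootsMod N (A i)) : HasRootsMod N (DirectSum ι A) := fun a z hz ↦ by
  classical
  change z ∈ (zsmulAddGroupHom a : DirectSum ι A →+ _).range
  rw [← DirectSum.sum_support_of z]
  refine AddSubgroup.sum_mem _ fun i _ ↦ ?_
  obtain ⟨x, hx⟩ := hA i a (z i) fun k hk ↦ by
    exact DFunLike.congr_fun (hz k hk) i
  exact ⟨DirectSum.of A i x, by simp [← map_zsmul, hx]⟩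

theorem zmod {q M : ℕ} (hq0 : q ≠ 0) (hq : q.Coprime M) :
    HasRootsMod (q * M) (ZMod q) := fun a z hz ↦ by
  obtain ⟨z, rfl⟩ := ZMod.intCast_surjective z
  obtain ⟨b, hb⟩ : (Int.gcd a q : ℤ) ∣ a := Int.gcd_dvd_left ..
  obtain ⟨r, hr⟩ : (Int.gcd a q : ℤ) ∣ q := Int.gcd_dvd_right ..
  have hz' : (q : ℤ) ∣ r * M * z := by
    rw [← ZMod.intCast_zmod_eq_zero_iff_dvd]
    have := hz (r * M) ⟨b, by push_cast; linear_combination r * M * hb - b * M * hr⟩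
    simpa using this
  have hg : (Int.gcd a q : ℤ) ∣ z := by
    have hr0 : r ≠ 0 := by
      rintro rfl
      exact hq0 (by simpa using hr)
    have : (Int.gcd a q : ℤ) ∣ M * z := by
      rw [mul_assoc, hr, mul_comm] at hz'
      exact (mul_dvd_mul_iff_left hr0).1 hz'
    refine IsCoprime.dvd_of_dvd_mul_left ?_ this
    exact (Nat.isCoprime_iff_coprime.2 hq).of_isCoprime_of_dvd_left ⟨r, hr⟩
  obtain ⟨c, rfl⟩ := hg
  refine ⟨(Int.gcdA a q * c : ℤ), ?_⟩
  have := Int.gcd_eq_gcd_ab a q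
  rw [this]
  simp
  ring

end HasRootsMod

theorem isStrongRetract_of_hasRootsMod {H : Type u} [CommGroup H] {N : ℕ}
    (hN : ∀ h : H, h ^ N = 1) (hH : HasRootsMod N (Additive H)) : IsStrongRetract H := by
  intro G _ ι hι hG
  let : CommGroup G := { mul_comm := hG.mul_comm mul_comm }
  let : Module (ZMod N) (Additive H) := AddCommGroup.zmodModule (n := N) hN
  let : Module (ZMod N) (Additive G) := AddCommGroup.zmodModule (n := N) (hG.pow_eq_one hN)
  obtain ⟨ρ, hρ⟩ := hH.baer.extension_property (ι.toAdditive.toZModLinearMap N) hι LinearMap.id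
  exact ⟨MonoidHom.toAdditive.symm ρ.toAddMonoidHom,
    fun h ↦ DFunLike.congr_fun hρ (Additive.ofMul h)⟩

/-- Retract the group obtained from `H` by adjoining a root of `z`. -/
theorem IsStrongRetract.hasRootsMod {H : Type u} [CommGroup H] (hH : IsStrongRetract H) :
    HasRootsMod (Monoid.exponent H) (Additive H) := fun a z hz ↦ by
  set N := Monoid.exponent H
  let C := AddSubgroup.zmultiples ((z, -(a : ZMod N)) : Additive H × ZMod N)
  let π := QuotientAddGroup.mk' C
  have key : InVarietyOf H (Multiplicative ((Additive H × ZMod N) ⧸ C)) := by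
    refine .of_pow_exponent fun k ↦ ?_
    obtain ⟨⟨x, y⟩, hk⟩ := QuotientAddGroup.mk'_surjective C k.toAdd
    change N • k.toAdd = 0
    rw [← hk, ← map_nsmul]
    have hx : N • x = 0 := Monoid.pow_exponent_eq_one x.toMul
    have : N • (x, y) = (0 : Additive H × ZMod N) := by
      ext
      · exact hx
      · simp
    rw [this, map_zero]
  obtain ⟨ρ, hρ⟩ := hH (Multiplicative ((Additive H × ZMod N) ⧸ C))
    (AddMonoidHom.toMultiplicativeRight (π.comp (AddMonoidHom.inl _ _)))
    ((injective_iff_map_eq_one _).2 fun h hh ↦ by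
      have : ((Additive.ofMul h, 0) : Additive H × ZMod N) ∈ C :=
        (QuotientAddGroup.eq_zero_iff _).1 hh
      obtain ⟨k, hk⟩ := AddSubgroup.mem_zmultiples_iff.1 this
      rw [Prod.ext_iff] at hk
      have := hz k ((ZMod.intCast_zmod_eq_zero_iff_dvd _ _).1 (by simpa using hk.2))
      exact hk.1.symm.trans this) key
  let σ := MonoidHom.toAdditiveRight ρ
  refine ⟨σ (π (0, 1)), ?_⟩
  have h₁ : σ (π (z, 0)) = z := hρ z.toMul
  rw [← map_zsmul, ← map_zsmul]
  refine Eq.trans ?_ h₁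
  congr 1
  refine QuotientAddGroup.eq.2 (AddSubgroup.mem_zmultiples_iff.2 ⟨1, ?_⟩)
  ext <;> simp

/-- If a group `A` of exponent dividing `p ^ k` is such that each element killed by `p ^ n` is
divisible by `p ^ (k - n)`, then any lift of a basis of `A / pA` is a basis of `A`. -/
theorem bijective_linearCombination_of_basis_mod_prime {A V I : Type*} [AddCommGroup A]
    [AddCommGroup V] {p k : ℕ} [Fact p.Prime] [Module (ZMod (p ^ k)) A] [Module (ZMod p) V]
    (hk : 1 ≤ k) (hdiv : ∀ n ≤ k, ∀ z : A, p ^ n • z = 0 → ∃ x, p ^ (k - n) • x = z)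
    (π : A →+ V) (hπ : ∀ z, π z = 0 ↔ ∃ x, p • x = z) (v : Module.Basis I (ZMod p) V) (b : I → A)
    (hb : ∀ i, π (b i) = v i) :
    Function.Bijective (Finsupp.linearCombination (ZMod (p ^ k)) b) := by
  have hA (z : A) : p ^ k • z = 0 := by
    rw [← Nat.cast_smul_eq_nsmul (ZMod (p ^ k)), ZMod.natCast_self, zero_smul]
  let φ := Finsupp.linearCombination (ZMod (p ^ k)) b
  have hpk : p ∣ p ^ k := dvd_pow_self p (by omega)
  let r : (I →₀ ZMod (p ^ k)) →+ (I →₀ ZMod p) :=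
    Finsupp.mapRange.addMonoidHom (ZMod.castHom hpk (ZMod p)).toAddMonoidHom
  have hr : Function.Surjective r :=
    Finsupp.mapRange_surjective _ (map_zero _) (ZMod.castHom_surjective hpk)
  have hφ (f : I →₀ ZMod (p ^ k)) :
      π (φ f) = Finsupp.linearCombination (ZMod p) v (r f) := by
    refine DFunLike.congr_fun (Finsupp.addHom_ext
      (f := π.comp φ.toAddMonoidHom)
      (g := (Finsupp.linearCombination (ZMod p) v).toAddMonoidHom.comp r) fun i c ↦ ?_) f
    obtain ⟨c, rfl⟩ := ZMod.intCast_surjective c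
    simp [φ, r, Int.cast_smul_eq_zsmul, hb]
  have hsurj (n : ℕ) (z : A) : ∃ f x, z = φ f + p ^ n • x := by
    induction n with
    | zero => exact ⟨0, z, by simp⟩
    | succ n ih =>
      obtain ⟨f, x, rfl⟩ := ih
      obtain ⟨g, hg⟩ := v.repr.symm.surjective (π x)
      obtain ⟨g, rfl⟩ := hr g
      obtain ⟨y, hy⟩ := (hπ (x - φ g)).1 (by
        rw [map_sub, hφ g, ← hg, v.repr_symm_apply, sub_self])
      refine ⟨f + p ^ n • g, y, ?_⟩
      rw [pow_succ, mul_smul, map_add, map_nsmul]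
      rw [hy, smul_sub]
      abel
  have hinj (f : I →₀ ZMod (p ^ k)) (hf : φ f = 0) (n : ℕ) (hn : n ≤ k) : ∃ g, f = p ^ n • g := by
    induction n with
    | zero => exact ⟨f, by simp⟩
    | succ n ih =>
      obtain ⟨g, rfl⟩ := ih (by omega)
      obtain ⟨x, hx⟩ := hdiv n (by omega) (φ g) (by rw [← map_nsmul, hf])
      have hg : r g = 0 := by
        rw [← map_eq_zero_iff _ v.repr.symm.injective, v.repr_symm_apply]
        refine (hφ g).symm.trans ((hπ _).2 ⟨p ^ (k - n - 1) • x, ?_⟩)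
        rw [← hx, smul_smul, ← pow_succ']
        congr 2
        omega
      obtain ⟨h, rfl⟩ : g ∈ (nsmulAddMonoidHom p : (I →₀ ZMod (p ^ k)) →+ _).range := by
        rw [← g.sum_single]
        refine AddSubgroup.sum_mem _ fun i _ ↦ ?_
        obtain ⟨c, hc⟩ := ZMod.intCast_surjective (g i)
        have hi : (ZMod.castHom hpk (ZMod p)) (g i) = 0 := DFunLike.congr_fun hg i
        rw [← hc, map_intCast] at hi
        obtain ⟨d, rfl⟩ := (ZMod.intCast_zmod_eq_zero_iff_dvd c p).1 hi
        exact ⟨Finsupp.single i (d : ZMod (p ^ k)), by simp [← hc]⟩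
      exact ⟨h, by rw [pow_succ, mul_smul]; rfl⟩
  refine ⟨?_, fun z ↦ ?_⟩
  · refine (injective_iff_map_eq_zero _).2 fun f hf ↦ ?_
    obtain ⟨g, rfl⟩ := hinj f hf k le_rfl
    ext i
    simp
  · obtain ⟨f, x, rfl⟩ := hsurj k z
    exact ⟨f, by simp [hA, φ]⟩

/-- An abelian `p`-group of exponent dividing `p ^ k` is free over `ZMod (p ^ k)` as soon as each
element killed by `p ^ n` is divisible by `p ^ (k - n)`. -/
theorem AddCommGroup.exists_addEquiv_finsupp_zmod {A : Type u} [AddCommGroup A] {p k : ℕ}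
    (hp : p.Prime) (hk : 1 ≤ k) (hA : ∀ z : A, p ^ k • z = 0)
    (hdiv : ∀ n ≤ k, ∀ z : A, p ^ n • z = 0 → ∃ x, p ^ (k - n) • x = z) :
    ∃ I : Type u, Nonempty (A ≃+ (I →₀ ZMod (p ^ k))) := by
  have : Fact p.Prime := ⟨hp⟩
  let _ : Module (ZMod (p ^ k)) A := AddCommGroup.zmodModule hA
  obtain ⟨V, _, _, π, hπ_surj, hπ⟩ : ∃ (V : Type u) (_ : AddCommGroup V) (_ : Module (ZMod p) V)
      (π : A →+ V), Function.Surjective π ∧ ∀ z, π z = 0 ↔ ∃ x, p • x = z := by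
    let P : AddSubgroup A := (nsmulAddMonoidHom p : A →+ A).range
    exact ⟨A ⧸ P, inferInstance, QuotientAddGroup.zmodModule fun x ↦ ⟨x, rfl⟩,
      QuotientAddGroup.mk' P, QuotientAddGroup.mk'_surjective P, QuotientAddGroup.eq_zero_iff⟩
  let v := Module.Basis.ofVectorSpace (ZMod p) V
  choose b hb using fun i ↦ hπ_surj (v i)
  exact ⟨_, ⟨(AddEquiv.ofBijective (Finsupp.linearCombination (ZMod (p ^ k)) b).toAddMonoidHom
    (bijective_linearCombination_of_basis_mod_prime hk hdiv π hπ v b hb)).symm⟩⟩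

open DirectSum in
theorem HasRootsMod.exists_addEquiv_directSum {A : Type u} [AddCommGroup A] {N : ℕ} (hN0 : N ≠ 0)
    (hN : ∀ z : A, N • z = 0) (hA : HasRootsMod N A) :
    ∃ (m : ℕ) (p k : Fin m → ℕ) (I : Fin m → Type u),
      (∀ i, (p i).Prime) ∧ Function.Injective p ∧ (∀ i, 1 ≤ k i) ∧
      Nonempty (A ≃+ ⨁ i, (I i →₀ ZMod (p i ^ k i))) := by
  classical
  let q (p : ℕ) : ℤ := (p ^ N.factorization p : ℕ)
  have hprod : ∏ p ∈ N.primeFactors, q p = N := by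
    rw [← Nat.cast_prod]
    exact congrArg _ (Nat.prod_factorization_pow_eq_self hN0)
  have hint : DirectSum.IsInternal fun p : N.primeFactors ↦ Submodule.torsionBy ℤ A (q p) := by
    refine Submodule.torsionBy_isInternal (fun a ha b hb hab ↦ ?_) fun z ↦ ?_
    · exact Nat.isCoprime_iff_coprime.2 (((Nat.coprime_primes (Nat.prime_of_mem_primeFactors ha)
        (Nat.prime_of_mem_primeFactors hb)).2 hab).pow _ _)
    · rw [hprod, natCast_zsmul, hN]
  have hcomp (p : N.primeFactors) : ∃ I : Type u, Nonempty
      (Submodule.torsionBy ℤ A (q p) ≃+ (I →₀ ZMod ((p : ℕ) ^ N.factorization p))) := by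
    obtain ⟨p, hp⟩ := p
    have hpp := Nat.prime_of_mem_primeFactors hp
    have hkill (z : Submodule.torsionBy ℤ A (q p)) : p ^ N.factorization p • z = 0 := by
      ext
      have := (Submodule.mem_torsionBy_iff _ _).1 z.2
      rwa [natCast_zsmul] at this
    refine AddCommGroup.exists_addEquiv_finsupp_zmod hpp
      (hpp.factorization_pos_of_dvd hN0 (Nat.dvd_of_mem_primeFactors hp)) hkill fun n hn z hz ↦ ?_
    obtain ⟨M, hM⟩ := Nat.ordProj_dvd N p
    have hpow : p ^ n * p ^ (N.factorization p - n) = p ^ N.factorization p := by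
      rw [← pow_add, Nat.add_sub_cancel' hn]
    obtain ⟨x, hx⟩ := hA (p ^ (N.factorization p - n) * M : ℕ) (z : A) fun c hc ↦ by
      have hc' : ((p ^ n : ℕ) : ℤ) ∣ c := by
        have h0 : ((p ^ (N.factorization p - n) * M : ℕ) : ℤ) ≠ 0 := by
          rw [Nat.cast_ne_zero]
          rintro h0
          rw [← hpow, mul_assoc, h0, mul_zero] at hM
          exact hN0 hM
        refine (mul_dvd_mul_iff_right h0).1 ?_
        rwa [← Nat.cast_mul, ← mul_assoc, hpow, ← hM]
      obtain ⟨d, rfl⟩ := hc'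
      have := congrArg Subtype.val hz
      rw [mul_comm, mul_smul, natCast_zsmul]
      exact (congrArg (d • ·) this).trans (smul_zero d)
    have hMx : M • x ∈ Submodule.torsionBy ℤ A (q p) := by
      rw [Submodule.mem_torsionBy_iff, natCast_zsmul, smul_smul, ← hM, hN]
    refine ⟨⟨M • x, hMx⟩, Subtype.ext (Eq.trans ?_ hx)⟩
    exact ((natCast_zsmul x _).trans (mul_smul _ M x)).symm
  choose I hI using hcomp
  let e := N.primeFactors.equivFin
  refine ⟨_, fun i ↦ e.symm i, fun i ↦ N.factorization (e.symm i), fun i ↦ I (e.symm i),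
    fun i ↦ Nat.prime_of_mem_primeFactors (e.symm i).2,
    Subtype.val_injective.comp e.symm.injective, fun i ↦ ?_, ⟨?_⟩⟩
  · exact (Nat.prime_of_mem_primeFactors (e.symm i).2).factorization_pos_of_dvd hN0
      (Nat.dvd_of_mem_primeFactors (e.symm i).2)
  · exact (LinearEquiv.ofBijective (DirectSum.coeLinearMap _) hint).symm.toAddEquiv.trans
      ((DFinsupp.mapRange.addEquiv fun p ↦ (hI p).some).trans (DirectSum.equivCongrLeft e))

/-- Theorem (description of nilpotent strong retracts): a nilpotent group is a strong
retract if and only if it is abelian and either divisible, or of bounded period and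
decomposing as a direct sum ⊕_{i=1}^m C_{p_i^{k_i}}(n_i) with distinct primes pᵢ
(so that orders of distinct primary cyclic summands are equal or coprime). -/
theorem nilpotent_strong_retract_characterization (G : Type u) [Group G]
    [Group.IsNilpotent G] :
    IsStrongRetract G ↔
      (∀ a b : G, a * b = b * a) ∧
        ((∀ (g : G) (n : ℕ), 1 ≤ n → ∃ x : G, x ^ n = g) ∨
          ((∃ n : ℕ, 1 ≤ n ∧ ∀ g : G, g ^ n = 1) ∧
            ∃ (m : ℕ) (p k : Fin m → ℕ) (I : Fin m → Type u),
              (∀ i, (p i).Prime) ∧ Function.Injective p ∧ (∀ i, 1 ≤ k i) ∧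
              Nonempty (G ≃* Multiplicative
                (DirectSum (Fin m) fun i => (I i →₀ ZMod (p i ^ k i)))))) := by
  constructor
  · intro hG
    have hcomm := Group.mul_comm_of_commutator_inf_center hG.commutator_inf_center_eq_bot
    let _ : CommGroup G := { mul_comm := hcomm }
    have hroots := hG.hasRootsMod
    refine ⟨hcomm, ?_⟩
    rcases eq_or_ne (Monoid.exponent G) 0 with h0 | h0
    · left
      intro g n hn
      obtain ⟨x, hx⟩ := hroots n (Additive.ofMul g) fun k hk ↦ by
        have : k = 0 := by simpa [h0, show n ≠ 0 by omega] using hk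
        simp [this]
      exact ⟨x.toMul, by simpa using congrArg Additive.toMul hx⟩
    · right
      refine ⟨⟨_, Nat.one_le_iff_ne_zero.2 h0, Monoid.pow_exponent_eq_one⟩, ?_⟩
      obtain ⟨m, p, k, I, hp, hinj, hk, ⟨e⟩⟩ :=
        hroots.exists_addEquiv_directSum h0 (Monoid.pow_exponent_eq_one (G := G))
      exact ⟨m, p, k, I, hp, hinj, hk, ⟨AddEquiv.toMultiplicativeRight e⟩⟩
  · rintro ⟨hcomm, h⟩
    let _ : CommGroup G := { mul_comm := hcomm }
    rcases h with h | ⟨-, m, p, k, I, hp, hinj, -, ⟨e⟩⟩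
    · exact isStrongRetract_of_hasRootsMod (N := 0) (by simp) (.of_divisible _ h)
    · have hdvd (i : Fin m) : p i ^ k i ∣ ∏ j, p j ^ k j :=
        Finset.dvd_prod_of_mem (fun j ↦ p j ^ k j) (Finset.mem_univ i)
      refine isStrongRetract_of_hasRootsMod (N := ∏ i, p i ^ k i) (fun h ↦ ?_)
        (HasRootsMod.of_addEquiv (.directSum fun i ↦ .finsupp ?_) (MulEquiv.toAdditiveLeft e).symm)
      · refine e.injective ?_
        rw [map_pow, map_one]
        change (∏ i, p i ^ k i) • (e h).toAdd = 0
        ext i j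
        change (∏ i, p i ^ k i) • (e h).toAdd i j = 0
        rw [nsmul_eq_mul, (ZMod.natCast_eq_zero_iff _ _).2 (hdvd i), zero_mul]
      · rw [← Finset.mul_prod_erase _ _ (Finset.mem_univ i)]
        refine .zmod (pow_ne_zero _ (hp i).ne_zero) (Nat.Coprime.prod_right fun j hj ↦ ?_)
        exact ((Nat.coprime_primes (hp i) (hp j)).2
          (hinj.ne (Finset.ne_of_mem_erase hj).symm)).pow _ _
end

section
/- If G is a strong retract, then the center Z(G) is a direct factor of G: there exists a normal subgroup D of G with D ∩ Z(G) = {1} and D·Z(G) = G. -/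
universe u

/-- A product of two copies of a group belongs to the variety it generates. -/
theorem inVarietyOf_prod_self (G : Type u) [Group G] : InVarietyOf G (G × G) := by
  intro n w hw f
  have hfst : (MonoidHom.fst G G).comp (FreeGroup.lift f) = FreeGroup.lift (fun i => (f i).1) := by
    ext i; simp
  have hsnd : (MonoidHom.snd G G).comp (FreeGroup.lift f) = FreeGroup.lift (fun i => (f i).2) := by
    ext i; simp
  exact Prod.ext ((DFunLike.congr_fun hfst w).trans (hw _))
    ((DFunLike.congr_fun hsnd w).trans (hw _))

/-- Varieties are closed under homomorphic images. -/
theorem InVarietyOf.of_surjective_s3 {H K L : Type u} [Group H] [Group K] [Group L]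
    (h : InVarietyOf H K) (φ : K →* L) (hφ : Function.Surjective φ) : InVarietyOf H L := by
  intro n w hw f
  choose s hs using hφ
  have hlift : φ.comp (FreeGroup.lift (fun i => s (f i))) = FreeGroup.lift f := by
    ext i; simp [hs]
  rw [← hlift, MonoidHom.comp_apply, h n w hw, map_one]

/-- The central subgroup `{(z, z⁻¹) | z ∈ Z(G)}` of `G × G`. -/
def centerAntidiagonal (G : Type u) [Group G] : Subgroup (G × G) where
  carrier := {p | p.1 ∈ Subgroup.center G ∧ p.2 = p.1⁻¹}
  one_mem' := by simp
  mul_mem' := by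
    rintro ⟨a, c⟩ ⟨b, d⟩ ⟨ha, hac⟩ ⟨hb, hbd⟩
    obtain rfl : c = a⁻¹ := hac
    obtain rfl : d = b⁻¹ := hbd
    refine ⟨mul_mem ha hb, ?_⟩
    change a⁻¹ * b⁻¹ = (a * b)⁻¹
    rw [← mul_inv_rev, (Subgroup.mem_center_iff.mp ha b)]
  inv_mem' := by
    rintro ⟨a, c⟩ ⟨ha, hac⟩
    obtain rfl : c = a⁻¹ := hac
    exact ⟨inv_mem ha, rfl⟩

theorem mem_centerAntidiagonal {G : Type u} [Group G] {p : G × G} :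
    p ∈ centerAntidiagonal G ↔ p.1 ∈ Subgroup.center G ∧ p.2 = p.1⁻¹ := Iff.rfl

instance centerAntidiagonal_normal (G : Type u) [Group G] : (centerAntidiagonal G).Normal where
  conj_mem := by
    rintro ⟨a, c⟩ ⟨ha, hac⟩ ⟨g, h⟩
    obtain rfl : c = a⁻¹ := hac
    have hconj (x y : G) (hy : y ∈ Subgroup.center G) : x * y * x⁻¹ = y := by
      rw [Subgroup.mem_center_iff.mp hy x, mul_inv_cancel_right]
    have heq : (g, h) * (a, a⁻¹) * (g, h)⁻¹ = (a, a⁻¹) :=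
      Prod.ext (hconj g a ha) (hconj h a⁻¹ (inv_mem ha))
    rw [heq]
    exact ⟨ha, rfl⟩

/-- A strong retract admits a homomorphism onto its center which is the identity there. -/
theorem IsStrongRetract.exists_retraction_center {G : Type u} [Group G]
    (hG : IsStrongRetract G) :
    ∃ φ : G →* G, (∀ g, φ g ∈ Subgroup.center G) ∧ ∀ z ∈ Subgroup.center G, φ z = z := by
  let π := QuotientGroup.mk' (centerAntidiagonal G)
  obtain ⟨ρ, hρ⟩ := hG ((G × G) ⧸ centerAntidiagonal G) (π.comp (MonoidHom.inl G G))
    (by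
      rw [injective_iff_map_eq_one]
      intro g hg
      have hmem := mem_centerAntidiagonal.mp ((QuotientGroup.eq_one_iff _).mp hg)
      simpa using hmem.2.symm)
    ((inVarietyOf_prod_self G).of_surjective_s3 π (QuotientGroup.mk'_surjective _))
  have hρ_inl (g : G) : ρ (π (g, 1)) = g := hρ g
  refine ⟨(ρ.comp π).comp (MonoidHom.inr G G), fun g => ?_, fun z hz => ?_⟩
  · rw [Subgroup.mem_center_iff]
    intro h
    have hcomm : Commute ((h, 1) : G × G) (1, g) := by
      simp [Commute, SemiconjBy]
    have himage := (hcomm.map π).map ρ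
    rw [hρ_inl h] at himage
    exact himage
  · have hπ : π (1, z) = π (z, 1) := by
      refine QuotientGroup.eq.mpr (mem_centerAntidiagonal.mpr ?_)
      simpa using hz
    exact (congrArg ρ hπ).trans (hρ_inl z)

/-- Proposition 3: the center of a strong retract is its direct factor. -/
theorem center_direct_factor_of_strong_retract (G : Type u) [Group G]
    (hG : IsStrongRetract G) :
    ∃ D : Subgroup G, D.Normal ∧ D ⊓ Subgroup.center G = ⊥ ∧
      ∀ g : G, ∃ d ∈ D, ∃ z ∈ Subgroup.center G, g = d * z := by
  obtain ⟨φ, hφ, hφ_center⟩ := hG.exists_retraction_center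
  refine ⟨φ.ker, inferInstance, ?_, fun g => ⟨g * (φ g)⁻¹, ?_, φ g, hφ g, by simp⟩⟩
  · rw [Subgroup.eq_bot_iff_forall]
    rintro z ⟨hker, hz⟩
    exact (hφ_center z hz).symm.trans hker
  · rw [MonoidHom.mem_ker, map_mul, map_inv, hφ_center _ (hφ g), mul_inv_cancel]
end

section
/- Every finitely generated nilpotent group whose torsion subgroup (the subgroup consisting of all elements of finite order, which is finite in a finitely generated nilpotent group) is nonabelian is not strongly verbally closed. -/
universe u

open Monoid in
/-- A subgroup `H` of `G` is verbally closed: every equation `w(x₁,…,xₙ) = h` with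
`w` in a free group and `h ∈ H` that has a solution in `G` has a solution in `H`. -/
def Subgroup.IsVerballyClosed {G : Type*} [Group G] (H : Subgroup G) : Prop :=
  ∀ (n : ℕ) (w : FreeGroup (Fin n)) (h : G), h ∈ H →
    (∃ f : Fin n → G, FreeGroup.lift f w = h) →
    ∃ f : Fin n → G, (∀ i, f i ∈ H) ∧ FreeGroup.lift f w = h

/-- A subgroup `H` of `G` is algebraically closed in `G`: every finite system of
equations `wᵢ(x₁,…,xₙ) = 1` with `wᵢ ∈ H ∗ F(x₁,…,xₙ)` (the free product of `H` with
a free group) that has a solution in `G` has a solution in `H`. -/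
def Subgroup.IsAlgebraicallyClosedIn {G : Type*} [Group G] (H : Subgroup G) : Prop :=
  ∀ (n m : ℕ) (w : Fin m → Monoid.Coprod H (FreeGroup (Fin n))),
    (∃ f : Fin n → G, ∀ i,
        Monoid.Coprod.lift H.subtype (FreeGroup.lift f) (w i) = 1) →
    ∃ f : Fin n → H, ∀ i,
        Monoid.Coprod.lift (MonoidHom.id H) (FreeGroup.lift f) (w i) = 1

/-- A group `H` is strongly verbally closed: it is algebraically closed in every group
containing it as a verbally closed subgroup. -/
def IsStronglyVerballyClosed (H : Type u) [Group H] : Prop :=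
  ∀ (G : Type u) [Group G], ∀ ι : H →* G, Function.Injective ι →
    ι.range.IsVerballyClosed → ι.range.IsAlgebraicallyClosedIn

open scoped commutatorElement

/-- In a nilpotent group a nontrivial normal subgroup meets the centre nontrivially. -/
theorem Subgroup.Normal.inf_center_ne_bot {G : Type*} [Group G] [Group.IsNilpotent G]
    {N : Subgroup G} [hN : N.Normal] (h : N ≠ ⊥) : N ⊓ Subgroup.center G ≠ ⊥ := by
  classical
  have hex : ∃ n, N ⊓ Subgroup.upperCentralSeries G n ≠ ⊥ := by
    obtain ⟨n, hn⟩ := Group.IsNilpotent.nilpotent G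
    exact ⟨n, by simpa [hn] using h⟩
  obtain ⟨m, hm⟩ : ∃ m, Nat.find hex = m + 1 :=
    Nat.exists_eq_succ_of_ne_zero fun h0 => by simpa [h0] using Nat.find_spec hex
  have hspec := Nat.find_spec hex
  have hmin : N ⊓ Subgroup.upperCentralSeries G m = ⊥ := by
    simpa using Nat.find_min hex (m := m) (by omega)
  rw [hm] at hspec
  obtain ⟨x, hx, hx1⟩ := (Subgroup.bot_or_exists_ne_one _).resolve_left hspec
  refine Subgroup.ne_bot_iff_exists_ne_one.2
    ⟨⟨x, hx.1, Subgroup.mem_center_iff.2 fun g => ?_⟩, fun h => hx1 (congrArg Subtype.val h)⟩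
  have hmem : ⁅x, g⁆ ∈ N ⊓ Subgroup.upperCentralSeries G m := by
    refine ⟨?_, Subgroup.mem_upperCentralSeries_succ_iff.1 hx.2 g⟩
    rw [commutatorElement_def, mul_assoc, mul_assoc]
    exact N.mul_mem hx.1 (by simpa [mul_assoc] using hN.conj_mem _ (N.inv_mem hx.1) g)
  rw [hmin, Subgroup.mem_bot, commutatorElement_eq_one_iff_mul_comm] at hmem
  exact hmem.symm

/-- A nilpotent group generated by finitely many elements of finite order is finite. -/
theorem Group.IsNilpotent.finite_of_closure_torsion (G : Type u) [Group G] [Group.IsNilpotent G] :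
    ∀ S : Set G, S.Finite → (∀ s ∈ S, IsOfFinOrder s) → Subgroup.closure S = ⊤ → Finite G := by
  refine Group.nilpotent_center_quotient_ind (P := fun G _ _ => ∀ S : Set G, S.Finite →
    (∀ s ∈ S, IsOfFinOrder s) → Subgroup.closure S = ⊤ → Finite G) G ?_ ?_
  · intros
    infer_instance
  · intro G _ _ ih S hS htor hgen
    have hq : Finite (G ⧸ Subgroup.center G) := by
      refine ih (QuotientGroup.mk' _ '' S) (hS.image _) ?_ ?_
      · rintro _ ⟨s, hs, rfl⟩
        exact (QuotientGroup.mk' _).isOfFinOrder (htor s hs)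
      · rw [← MonoidHom.map_closure, hgen, ← MonoidHom.range_eq_map]
        exact MonoidHom.range_eq_top.2 (QuotientGroup.mk'_surjective _)
    have hcomm : Finite (commutatorSet G) := by
      let c : (G ⧸ Subgroup.center G) × (G ⧸ Subgroup.center G) → G := fun q =>
        ⁅q.1.out, q.2.out⁆
      refine ((Set.finite_range c).subset ?_).to_subtype
      rintro _ ⟨a, b, rfl⟩
      obtain ⟨u, hu⟩ := QuotientGroup.mk_out_eq_mul (Subgroup.center G) a
      obtain ⟨v, hv⟩ := QuotientGroup.mk_out_eq_mul (Subgroup.center G) b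
      refine ⟨(a, b), ?_⟩
      have hu' := Subgroup.mem_center_iff.1 u.2
      have hv' := Subgroup.mem_center_iff.1 v.2
      simp only [c, hu, hv, commutatorElement_def]
      have e1 : a * u * (b * v) = a * b * (u * v) := by
        rw [mul_assoc a, ← mul_assoc (u : G), ← hu' b]; simp only [mul_assoc]
      have e2 : b * v * (a * u) = b * a * (u * v) := by
        rw [mul_assoc b, ← mul_assoc (v : G), ← hv' a, mul_assoc a, hu' v]; simp only [mul_assoc]
      have e3 (x y : G) : x * y * x⁻¹ * y⁻¹ = x * y * (y * x)⁻¹ := by group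
      rw [e3, e1, e2, e3]
      group
    have hfg : Group.FG (Abelianization G) := by
      have : Group.FG G := ⟨⟨hS.toFinset, by simpa using hgen⟩⟩
      exact Group.fg_of_surjective (f := Abelianization.of) QuotientGroup.mk_surjective
    have hab : Finite (Abelianization G) := by
      refine CommGroup.finite_of_fg_isMulTorsion _ ?_
      have hle : Subgroup.closure S ≤ (CommGroup.torsion (Abelianization G)).comap
          Abelianization.of := by
        rw [Subgroup.closure_le]
        exact fun s hs => Abelianization.of.isOfFinOrder (htor s hs)
      rw [hgen] at hle
      intro x
      obtain ⟨g, rfl⟩ := QuotientGroup.mk_surjective x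
      exact hle (Subgroup.mem_top g)
    have : Finite (G ⧸ commutator G) := hab
    exact Finite.of_subgroup_quotient (commutator G)

/-- In a nilpotent group finitely many elements of finite order generate a finite subgroup. -/
theorem Subgroup.finite_closure_of_isOfFinOrder {G : Type u} [Group G] [Group.IsNilpotent G]
    {S : Set G} (hS : S.Finite) (htor : ∀ s ∈ S, IsOfFinOrder s) : Finite (closure S) := by
  refine Group.IsNilpotent.finite_of_closure_torsion (closure S) (Subtype.val ⁻¹' S)
    (hS.preimage Subtype.val_injective.injOn) (fun t ht => ?_) closure_closure_coe_preimage
  exact ((closure S).subtype_injective.isOfFinOrder_iff (f := (closure S).subtype)).1 (htor _ ht)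

/-- Modulo the next term, every term of the lower central series of a finitely generated group is
finitely generated. -/
theorem Subgroup.exists_finite_lowerCentralSeries_le (G : Type*) [Group G] [Group.FG G] (n : ℕ) :
    ∃ S : Set G, S.Finite ∧ S ⊆ (⊤ : Subgroup G).lowerCentralSeries n ∧
      (⊤ : Subgroup G).lowerCentralSeries n ≤
        Subgroup.closure S ⊔ (⊤ : Subgroup G).lowerCentralSeries (n + 1) := by
  obtain ⟨X, hX, hXfin⟩ := (Subgroup.fg_iff _).1 (Group.FG.out (G := G))
  induction n with
  | zero => exact ⟨X, hXfin, by simp, by simp [hX]⟩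
  | succ n ih =>
    obtain ⟨S, hS, hSn, hle⟩ := ih
    set γ := (⊤ : Subgroup G).lowerCentralSeries
    have hγsucc (m : ℕ) {a : G} (ha : a ∈ γ m) (g : G) : ⁅a, g⁆ ∈ γ (m + 1) :=
      Subgroup.commutator_mem_commutator ha (Subgroup.mem_top g)
    let C : Set G := Set.image2 (fun s t => ⁅s, t⁆) S X
    have hC : C ⊆ γ (n + 1) := by
      rintro _ ⟨s, hs, t, -, rfl⟩
      exact hγsucc n (hSn hs) t
    refine ⟨C, hS.image2 _ hXfin, hC, ?_⟩
    set K := Subgroup.closure C ⊔ γ (n + 1 + 1)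
    have hKγ : K ≤ γ (n + 1) :=
      sup_le ((Subgroup.closure_le _).2 hC) (Subgroup.lowerCentralSeries_antitone _ (by omega))
    have hKn : K.Normal := by
      refine ⟨fun k hk g => ?_⟩
      have h1 : ⁅k, g⁆⁻¹ ∈ K := K.inv_mem (le_sup_right (a := Subgroup.closure C)
        (hγsucc (n + 1) (hKγ hk) g))
      have h2 := K.mul_mem h1 hk
      rwa [commutatorElement_inv, commutatorElement_def, inv_mul_cancel_right] at h2
    let π := QuotientGroup.mk' K
    have hcomm (a g : G) : ⁅a, g⁆ ∈ K ↔ π a * π g = π g * π a := by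
      rw [← commutatorElement_eq_one_iff_mul_comm, ← map_commutatorElement]
      exact (QuotientGroup.eq_one_iff _).symm
    have hcentral : γ n ≤ (Subgroup.center (G ⧸ K)).comap π := by
      refine hle.trans (sup_le ((Subgroup.closure_le _).2 fun s hs => ?_) fun a ha => ?_)
      · have hcl : Subgroup.closure X ≤ (Subgroup.centralizer {π s}).comap π := by
          rw [Subgroup.closure_le]
          intro t ht
          refine Subgroup.mem_centralizer_singleton_iff.2 ?_
          exact ((hcomm s t).1 (le_sup_left (b := γ (n + 1 + 1))
            (Subgroup.subset_closure ⟨s, hs, t, ht, rfl⟩))).symm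
        rw [hX] at hcl
        refine Subgroup.mem_center_iff.2 fun q => ?_
        obtain ⟨g, rfl⟩ := QuotientGroup.mk'_surjective K q
        exact Subgroup.mem_centralizer_singleton_iff.1 (hcl (Subgroup.mem_top g))
      · refine Subgroup.mem_center_iff.2 fun q => ?_
        obtain ⟨g, rfl⟩ := QuotientGroup.mk'_surjective K q
        exact ((hcomm a g).1 (le_sup_right (a := Subgroup.closure C)
          (hγsucc (n + 1) ha g))).symm
    refine (Subgroup.commutator_le).2 fun a ha g _ => (hcomm a g).2 ?_
    exact (Subgroup.mem_center_iff.1 (hcentral ha) (π g)).symm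

/-- A group with finitely many elements of finite order modulo a finitely generated central
subgroup has finitely many elements of finite order. -/
theorem finite_setOf_isOfFinOrder_of_quotient {G : Type*} [Group G] (A : Subgroup G) [A.Normal]
    (hA : A ≤ Subgroup.center G) (hfg : A.FG) (hq : {q : G ⧸ A | IsOfFinOrder q}.Finite) :
    {g : G | IsOfFinOrder g}.Finite := by
  have htorA : {a : G | a ∈ A ∧ IsOfFinOrder a}.Finite := by
    let _ : CommGroup A :=
      { (inferInstance : Group A) with
        mul_comm := fun a b => Subtype.ext (Subgroup.mem_center_iff.1 (hA b.2) a) }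
    have : Group.FG A := (Group.fg_iff_subgroup_fg A).2 hfg
    have : Module.Finite ℤ (Additive A) := Module.Finite.iff_addGroup_fg.2 inferInstance
    have hfin : (AddCommGroup.torsion (Additive A) : Set (Additive A)).Finite := by
      have : Module.Finite ℤ (Submodule.torsion ℤ (Additive A)) := inferInstance
      have h := Module.finite_of_fg_torsion _ (Submodule.torsion_isTorsion (R := ℤ) (M := Additive A))
      rw [← Submodule.torsion_int]
      exact h
    refine (hfin.image fun a => ((Additive.toMul a : A) : G)).subset ?_
    rintro a ⟨ha, hao⟩
    refine ⟨Additive.ofMul ⟨a, ha⟩, ?_, rfl⟩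
    exact isOfFinAddOrder_ofMul_iff.2 ((A.subtype_injective.isOfFinOrder_iff (f := A.subtype)).1 hao)
  refine Set.Finite.of_finite_fibers (QuotientGroup.mk : G → G ⧸ A) (hq.subset ?_) ?_
  · rintro _ ⟨g, hg, rfl⟩
    exact (QuotientGroup.mk' A).isOfFinOrder hg
  · rintro _ ⟨t, ht, rfl⟩
    refine (htorA.image (t * ·)).subset ?_
    rintro g ⟨hg, hgt⟩
    have hmem : t⁻¹ * g ∈ A := QuotientGroup.eq.1 hgt.symm
    refine ⟨t⁻¹ * g, ⟨hmem, ?_⟩, by simp⟩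
    have hc : Commute t (t⁻¹ * g) := Subgroup.mem_center_iff.1 (hA hmem) t
    have hc' : Commute t⁻¹ g := by
      have h' : Commute t g := by simpa using (Commute.refl t).mul_right hc
      exact h'.inv_left
    exact hc'.isOfFinOrder_mul ht.inv hg

theorem finite_setOf_isOfFinOrder_of_lowerCentralSeries_eq_bot (n : ℕ) :
    ∀ (G : Type u) [Group G] [Group.FG G], (⊤ : Subgroup G).lowerCentralSeries n = ⊥ →
      {g : G | IsOfFinOrder g}.Finite := by
  induction n with
  | zero =>
    intro G _ _ h
    have : Subsingleton G := Subgroup.subsingleton_iff.1 (subsingleton_of_bot_eq_top h.symm)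
    exact Set.toFinite _
  | succ n ih =>
    intro G _ _ h
    let A := (⊤ : Subgroup G).lowerCentralSeries n
    obtain ⟨S, hS, hSA, hle⟩ := Subgroup.exists_finite_lowerCentralSeries_le G n
    rw [h, sup_bot_eq] at hle
    refine finite_setOf_isOfFinOrder_of_quotient A ?_ ?_ (ih (G ⧸ A) ?_)
    · exact fun a ha => Subgroup.mem_center_iff.2 fun g => by
        have := Subgroup.commutator_mem_commutator ha (Subgroup.mem_top g)
        rw [← Subgroup.lowerCentralSeries_succ, h, Subgroup.mem_bot,
          commutatorElement_eq_one_iff_mul_comm] at this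
        exact this.symm
    · exact (Subgroup.fg_iff A).2 ⟨S, le_antisymm ((Subgroup.closure_le _).2 hSA) hle, hS⟩
    · have hmap := Subgroup.map_lowerCentralSeries (⊤ : Subgroup G) (QuotientGroup.mk' A) n
      rw [← MonoidHom.range_eq_map,
        MonoidHom.range_eq_top.2 (QuotientGroup.mk'_surjective A)] at hmap
      rw [← hmap]
      exact (Subgroup.map_eq_bot_iff _).2 (by simp [A])

/-- A finitely generated nilpotent group has only finitely many elements of finite order. -/
theorem Group.IsNilpotent.finite_setOf_isOfFinOrder (G : Type u) [Group G] [Group.FG G]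
    [Group.IsNilpotent G] : {g : G | IsOfFinOrder g}.Finite := by
  obtain ⟨n, hn⟩ := Subgroup.nilpotent_iff_lowerCentralSeries.1 ‹Group.IsNilpotent G›
  exact finite_setOf_isOfFinOrder_of_lowerCentralSeries_eq_bot n G hn

/-- For finitely many nonzero points there is a polynomial without constant term taking the value
`1` at all of them, of degree at most the number of points. -/
theorem MvPolynomial.exists_eval_eq_one {σ F : Type*} [Field F] (S : Finset (σ → F))
    (hS : ∀ s ∈ S, s ≠ 0) :
    ∃ f : MvPolynomial σ F, f.totalDegree ≤ S.card ∧ eval 0 f = 0 ∧ ∀ s ∈ S, eval s f = 1 := by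
  have hj (s : S) : ∃ j, s.1 j ≠ 0 := Function.ne_iff.1 (hS s s.2)
  choose j hj using hj
  let l : S → MvPolynomial σ F := fun s => 1 - C (s.1 (j s))⁻¹ * X (j s)
  have hl (s : S) : (l s).totalDegree ≤ 1 := by
    refine (totalDegree_sub _ _).trans (max_le (by simp) ?_)
    refine (totalDegree_mul _ _).trans ?_
    simp
  refine ⟨1 - ∏ s, l s, ?_, ?_, fun s hs => ?_⟩
  · refine (totalDegree_sub _ _).trans (max_le (by simp) ?_)
    refine (totalDegree_finsetProd _ _).trans ((Finset.sum_le_sum fun s _ => hl s).trans ?_)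
    simp
  · simp [l, map_prod]
  · have h0 : ∏ t, eval s (l t) = 0 :=
      Finset.prod_eq_zero (Finset.mem_univ ⟨s, hs⟩) (by simp [l, inv_mul_cancel₀ (hj ⟨s, hs⟩)])
    rw [map_sub, map_one, map_prod, h0, sub_zero]

/-- There is an additive group of `ZMod p`-valued functions on a finite set, each of which vanishes
somewhere, that contains for every `r`-element set a function constantly `1` on it. -/
theorem ZMod.exists_addSubgroup_vanishing (p : ℕ) [Fact p.Prime] (r : ℕ) :
    ∃ (I : Type) (_ : Fintype I) (V : AddSubgroup (I → ZMod p)),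
      (∀ v ∈ V, ∃ i, v i = 0) ∧
      ∀ S : Finset I, S.card ≤ r → ∃ v ∈ V, ∀ i ∈ S, v i = 1 := by
  classical
  let E := Fin (r + 1) → ZMod p
  let V : AddSubgroup ({x : E // x ≠ 0} → ZMod p) :=
    { carrier := {v | ∃ f : MvPolynomial (Fin (r + 1)) (ZMod p), f.totalDegree ≤ r ∧
        MvPolynomial.eval 0 f = 0 ∧ ∀ i, v i = MvPolynomial.eval i.1 f}
      zero_mem' := ⟨0, by simp, by simp, by simp⟩
      add_mem' := by
        rintro v w ⟨f, hf, hf0, hfv⟩ ⟨g, hg, hg0, hgw⟩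
        exact ⟨f + g, (MvPolynomial.totalDegree_add _ _).trans (max_le hf hg),
          by rw [map_add, hf0, hg0, add_zero], by simp [hfv, hgw]⟩
      neg_mem' := by
        rintro v ⟨f, hf, hf0, hfv⟩
        exact ⟨-f, by simpa using hf, by rw [map_neg, hf0, neg_zero], by simp [hfv]⟩ }
  refine ⟨{x : E // x ≠ 0}, inferInstance, V, ?_, fun S hS => ?_⟩
  · rintro v ⟨f, hf, hf0, hfv⟩
    have hdvd := char_dvd_card_solutions p (f := f) (by simpa using Nat.lt_succ_of_le hf)
    have hpos : 0 < Fintype.card {x : E // MvPolynomial.eval x f = 0} :=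
      Fintype.card_pos_iff.2 ⟨⟨0, hf0⟩⟩
    have hone := (Fact.out : p.Prime).one_lt.trans_le (Nat.le_of_dvd hpos hdvd)
    obtain ⟨x, hx⟩ := Fintype.exists_ne_of_one_lt_card hone ⟨0, hf0⟩
    exact ⟨⟨x.1, fun h => hx (Subtype.ext h)⟩, by rw [hfv]; exact x.2⟩
  · obtain ⟨f, hf, hf0, hf1⟩ := MvPolynomial.exists_eval_eq_one
      (S.map (Function.Embedding.subtype _)) (by
        rintro _ hs
        obtain ⟨i, -, rfl⟩ := Finset.mem_map.1 hs
        exact i.2)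
    rw [Finset.card_map] at hf
    exact ⟨fun i => MvPolynomial.eval i.1 f, ⟨f, hf.trans hS, hf0, fun _ => rfl⟩,
      fun i hi => hf1 i.1 (Finset.mem_map_of_mem _ hi)⟩

/-- The diagonal homomorphism from a group to a quotient of its power. -/
def diagonalQuotient {Γ I : Type*} [Group Γ] (N : Subgroup (I → Γ)) [N.Normal] :
    Γ →* (I → Γ) ⧸ N :=
  (QuotientGroup.mk' N).comp (Pi.constMonoidHom I Γ)

section diagonalQuotient

variable {Γ I : Type*} [Group Γ] {N : Subgroup (I → Γ)} [N.Normal]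

theorem diagonalQuotient_injective (hN : ∀ n ∈ N, ∃ i, n i = 1) :
    Function.Injective (diagonalQuotient N) := by
  refine (injective_iff_map_eq_one _).2 fun g hg => ?_
  obtain ⟨i, hi⟩ := hN _ ((QuotientGroup.eq_one_iff _).1 hg)
  exact hi

theorem isVerballyClosed_range_diagonalQuotient (hN : ∀ n ∈ N, ∃ i, n i = 1) :
    (diagonalQuotient N).range.IsVerballyClosed := by
  rintro n w _ ⟨g, rfl⟩ ⟨f, hf⟩
  choose F hF using fun k => QuotientGroup.mk'_surjective N (f k)
  obtain rfl : (fun k => QuotientGroup.mk' N (F k)) = f := funext hF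
  have hlift : QuotientGroup.mk' N (FreeGroup.lift F w) =
      FreeGroup.lift (fun k => QuotientGroup.mk' N (F k)) w :=
    FreeGroup.lift_unique ((QuotientGroup.mk' N).comp (FreeGroup.lift F)) (by simp)
  rw [← hlift] at hf
  obtain ⟨i, hi⟩ := hN _ (QuotientGroup.eq.1 hf)
  have hgi : FreeGroup.lift (fun k => F k i) w = g := by
    have h1 : FreeGroup.lift F w i = FreeGroup.lift (fun k => F k i) w :=
      FreeGroup.lift_unique ((Pi.evalMonoidHom (fun _ => Γ) i).comp (FreeGroup.lift F)) (by simp)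
    rw [← h1]
    exact inv_mul_eq_one.1 hi
  refine ⟨fun k => diagonalQuotient N (F k i), fun k => ⟨_, rfl⟩, ?_⟩
  rw [← hgi]
  exact (FreeGroup.lift_unique ((diagonalQuotient N).comp (FreeGroup.lift fun k => F k i))
    (by simp)).symm

end diagonalQuotient

/-- Algebraic closedness for systems of equations indexed by arbitrary finite types. -/
theorem Subgroup.IsAlgebraicallyClosedIn.exists_solution {G : Type*} [Group G] {H : Subgroup G}
    (hH : H.IsAlgebraicallyClosedIn) {α β : Type*} [Finite α] [Finite β]
    (w : β → Monoid.Coprod H (FreeGroup α)) (f : α → G)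
    (hf : ∀ b, Monoid.Coprod.lift H.subtype (FreeGroup.lift f) (w b) = 1) :
    ∃ f : α → H, ∀ b, Monoid.Coprod.lift (MonoidHom.id H) (FreeGroup.lift f) (w b) = 1 := by
  obtain ⟨n, ⟨e⟩⟩ := Finite.exists_equiv_fin α
  obtain ⟨m, ⟨e'⟩⟩ := Finite.exists_equiv_fin β
  let κ : Monoid.Coprod H (FreeGroup α) →* Monoid.Coprod H (FreeGroup (Fin n)) :=
    Monoid.Coprod.map (MonoidHom.id H) (FreeGroup.map e)
  have hκ {K : Type _} [Group K] (a : H →* K) (g : Fin n → K) :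
      (Monoid.Coprod.lift a (FreeGroup.lift g)).comp κ =
        Monoid.Coprod.lift a (FreeGroup.lift (g ∘ e)) := by
    ext <;> simp [κ]
  obtain ⟨g, hg⟩ := hH n m (fun i => κ (w (e'.symm i))) ⟨f ∘ e.symm, fun i => by
    rw [← MonoidHom.comp_apply, hκ]
    simpa [Function.comp_assoc] using hf (e'.symm i)⟩
  refine ⟨g ∘ e, fun b => ?_⟩
  have h := hg (e' b)
  rwa [← MonoidHom.comp_apply, hκ, Equiv.symm_apply_apply] at h

/-- The ordered product of the components of a tuple is the tuple itself. -/
theorem List.prod_map_mulSingle {I Γ : Type*} [DecidableEq I] [Group Γ] {L : List I}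
    (hL : L.Nodup) (hmem : ∀ i, i ∈ L) (g : I → Γ) :
    (L.map fun i => (Pi.mulSingle i (g i) : I → Γ)).prod = g := by
  funext j
  have h := map_list_prod (Pi.evalMonoidHom (fun _ : I => Γ) j)
    (L.map fun i => (Pi.mulSingle i (g i) : I → Γ))
  rw [Pi.evalMonoidHom_apply] at h
  rw [h, List.map_map, List.prod_map_eq_pow_single j, List.count_eq_one_of_mem hL (hmem j)]
  · simp
  · intro i hi _
    simp [Pi.mulSingle_eq_of_ne hi.symm]

/-- If the diagonal is algebraically closed in a quotient of a finite power, then the coordinate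
inclusions of a finite subgroup can be realized inside the group itself. -/
theorem exists_homs_of_isAlgebraicallyClosedIn {Γ I : Type*} [Group Γ] [Finite I]
    {N : Subgroup (I → Γ)} [N.Normal] (hN : Function.Injective (diagonalQuotient N))
    (hcl : (diagonalQuotient N).range.IsAlgebraicallyClosedIn) (T : Subgroup Γ) [Finite T] :
    ∃ (L : List I) (ψ : I → T →* Γ), (∀ i j, i ≠ j → ∀ s t, Commute (ψ i s) (ψ j t)) ∧
      (∀ t : T, (L.map fun i => ψ i t).prod = t) ∧
      ∀ g : I → T, (fun i => (g i : Γ)) ∈ N → (L.map fun i => ψ i (g i)).prod = 1 := by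
  classical
  have := Fintype.ofFinite I
  set ι := diagonalQuotient N
  let L := (Finset.univ : Finset I).toList
  have hL : L.Nodup := Finset.nodup_toList _
  have hmem (i : I) : i ∈ L := by simp [L]
  let X : I → T → Monoid.Coprod ι.range (FreeGroup (I × T)) := fun i t =>
    Monoid.Coprod.inr (FreeGroup.of (i, t))
  let wcomm : {q : I × I // q.1 ≠ q.2} × T × T → Monoid.Coprod ι.range (FreeGroup (I × T)) :=
    fun q => X q.1.1.1 q.2.1 * X q.1.1.2 q.2.2 * (X q.1.1.2 q.2.2 * X q.1.1.1 q.2.1)⁻¹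
  let wmul : I × T × T → Monoid.Coprod ι.range (FreeGroup (I × T)) :=
    fun q => X q.1 (q.2.1 * q.2.2) * (X q.1 q.2.1 * X q.1 q.2.2)⁻¹
  let wdiag : T → Monoid.Coprod ι.range (FreeGroup (I × T)) :=
    fun t => (L.map fun i => X i t).prod * (Monoid.Coprod.inl (ι.rangeRestrict t))⁻¹
  let wrel : {g : I → T // (fun i => (g i : Γ)) ∈ N} →
      Monoid.Coprod ι.range (FreeGroup (I × T)) :=
    fun g => (L.map fun i => X i (g.1 i)).prod
  let F : I × T → (I → Γ) ⧸ N := fun q => QuotientGroup.mk' N (Pi.mulSingle q.1 (q.2 : Γ))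
  have hprod (g : I → T) : (L.map fun i => F (i, g i)).prod =
      QuotientGroup.mk' N fun i => (g i : Γ) := by
    rw [← List.prod_map_mulSingle hL hmem fun i => (g i : Γ), map_list_prod, List.map_map]
    rfl
  obtain ⟨f, hf⟩ := hcl.exists_solution
    (Sum.elim wcomm (Sum.elim wmul (Sum.elim wdiag wrel))) F (by
      rintro (⟨⟨⟨i, j⟩, hij⟩, s, t⟩ | ⟨i, s, t⟩ | t | ⟨g, hg⟩)
      · simp only [Sum.elim_inl, wcomm, X, map_mul, map_inv, Monoid.Coprod.lift_apply_inr,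
          FreeGroup.lift_apply_of, mul_inv_eq_one, F]
        rw [← map_mul, ← map_mul, (Pi.mulSingle_commute (f := fun _ : I => Γ) hij s t).eq]
      · simp only [Sum.elim_inl, Sum.elim_inr, wmul, X, map_mul, map_inv,
          Monoid.Coprod.lift_apply_inr, FreeGroup.lift_apply_of, mul_inv_eq_one, F]
        rw [← map_mul, ← Pi.mulSingle_mul, Subgroup.coe_mul]
      · simp only [Sum.elim_inl, Sum.elim_inr, wdiag, X, map_mul, map_inv, map_list_prod,
          List.map_map, Function.comp_def, Monoid.Coprod.lift_apply_inr,
          Monoid.Coprod.lift_apply_inl, FreeGroup.lift_apply_of, mul_inv_eq_one]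
        exact hprod fun _ => t
      · simp only [Sum.elim_inr, wrel, X, map_list_prod,
          List.map_map, Function.comp_def, Monoid.Coprod.lift_apply_inr, FreeGroup.lift_apply_of]
        exact (hprod g).trans ((QuotientGroup.eq_one_iff _).2 hg))
  let e : ι.range ≃* Γ := (MonoidHom.ofInjective hN).symm
  have hmul (i : I) (s t : T) : f (i, s * t) = f (i, s) * f (i, t) := by
    have h := hf (Sum.inr (Sum.inl (i, s, t)))
    simpa only [Sum.elim_inl, Sum.elim_inr, wmul, X, map_mul, map_inv,
      Monoid.Coprod.lift_apply_inr, FreeGroup.lift_apply_of, mul_inv_eq_one] using h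
  refine ⟨L, fun i => MonoidHom.mk' (fun t => e (f (i, t))) fun s t => by rw [hmul, map_mul],
    fun i j hij s t => ?_, fun t => ?_, fun g hg => ?_⟩
  · have h := hf (Sum.inl (⟨⟨i, j⟩, hij⟩, s, t))
    simp only [Sum.elim_inl, wcomm, X, map_mul, map_inv, Monoid.Coprod.lift_apply_inr,
      FreeGroup.lift_apply_of, mul_inv_eq_one] at h
    exact (show Commute (f (i, s)) (f (j, t)) from h).map e
  · have h := hf (Sum.inr (Sum.inr (Sum.inl t)))
    simp only [Sum.elim_inl, Sum.elim_inr, wdiag, X, map_mul, map_inv, map_list_prod,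
      List.map_map, Function.comp_def, Monoid.Coprod.lift_apply_inr,
      Monoid.Coprod.lift_apply_inl, FreeGroup.lift_apply_of, mul_inv_eq_one] at h
    have h' := congrArg e h
    rw [map_list_prod, List.map_map] at h'
    exact h'.trans ((MonoidHom.ofInjective hN).symm_apply_apply (t : Γ))
  · have h := hf (Sum.inr (Sum.inr (Sum.inr ⟨g, hg⟩)))
    simp only [Sum.elim_inr, wrel, X, map_list_prod,
      List.map_map, Function.comp_def, Monoid.Coprod.lift_apply_inr,
      FreeGroup.lift_apply_of] at h
    have h' := congrArg e h
    rw [map_list_prod, List.map_map, map_one] at h'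
    exact h'

/-- Among pairwise commuting images of a group of torsion elements, at most as many are nonabelian
as there are torsion elements. -/
theorem card_nonabelian_le {Γ T I : Type*} [Group Γ] [Group T] [Finite T] (ψ : I → T →* Γ)
    (hψ : ∀ i j, i ≠ j → ∀ s t, Commute (ψ i s) (ψ j t)) {F : Finset Γ}
    (hF : ∀ g : Γ, IsOfFinOrder g → g ∈ F) (S : Finset I)
    (hS : ∀ i ∈ S, ∃ s t, ¬ Commute (ψ i s) (ψ i t)) : S.card ≤ F.card := by
  choose! a b hab using hS
  refine Finset.card_le_card_of_injOn (fun i => ψ i (a i))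
    (fun i _ => hF _ ((ψ i).isOfFinOrder (isOfFinOrder_of_finite _))) fun i hi j hj hij => ?_
  by_contra hne
  refine hab i hi ?_
  have hij' : ψ i (a i) = ψ j (a j) := hij
  rw [hij']
  exact hψ j i (Ne.symm hne) _ _

/-- A group with finitely many torsion elements is not strongly verbally closed as soon as the
derived subgroup of a finite subgroup contains a central element of prime order. -/
theorem not_isStronglyVerballyClosed_of_central {Γ : Type u} [Group Γ]
    (hfin : {g : Γ | IsOfFinOrder g}.Finite) (T : Subgroup Γ) [Finite T] (p : ℕ) [Fact p.Prime]
    (z : T) (hz : z ∈ commutator T) (hzc : (z : Γ) ∈ Subgroup.center Γ) (hzp : orderOf z = p) :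
    ¬ IsStronglyVerballyClosed Γ := by
  classical
  intro hsvc
  obtain ⟨I, _, V, hV0, hV1⟩ := ZMod.exists_addSubgroup_vanishing p hfin.toFinset.card
  let ζ : Multiplicative (ZMod p) →* T := MonoidHom.mk' (fun c => z ^ c.toAdd.val) fun a b => by
    rw [toAdd_mul, ZMod.val_add, ← pow_add, pow_eq_pow_iff_modEq, hzp]
    exact Nat.mod_modEq _ _
  have hζc (c) : (ζ c : Γ) ∈ Subgroup.center Γ := by
    simpa [ζ] using pow_mem hzc _
  let θ : Multiplicative (I → ZMod p) →* (I → Γ) :=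
    { toFun := fun v i => ζ (Multiplicative.ofAdd (v.toAdd i))
      map_one' := by funext i; simp
      map_mul' := fun v w => by funext i; simp }
  let N : Subgroup (I → Γ) := V.toSubgroup.map θ
  have hN : N.Normal := by
    refine ⟨?_⟩
    rintro _ ⟨v, hv, rfl⟩ g
    convert! (show θ v ∈ N from ⟨v, hv, rfl⟩)
    funext i
    change g i * (ζ _ : Γ) * (g i)⁻¹ = (ζ _ : Γ)
    rw [Subgroup.mem_center_iff.1 (hζc _) (g i), mul_inv_cancel_right]
  have hN1 : ∀ n ∈ N, ∃ i, n i = 1 := by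
    rintro _ ⟨v, hv, rfl⟩
    obtain ⟨i, hi⟩ := hV0 _ hv
    exact ⟨i, by simp [θ, show v.toAdd i = 0 from hi]⟩
  have hinj := diagonalQuotient_injective hN1
  obtain ⟨L, ψ, hcomm, hdiag, hrel⟩ := exists_homs_of_isAlgebraicallyClosedIn hinj
    (hsvc _ _ hinj (isVerballyClosed_range_diagonalQuotient hN1)) T
  let S : Finset I := {i | ∃ s t, ¬ Commute (ψ i s) (ψ i t)}
  have hScard := card_nonabelian_le ψ hcomm (F := hfin.toFinset) (by simp) S (by simp [S])
  obtain ⟨v, hv, hv1⟩ := hV1 S hScard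
  have hψz (i : I) (hi : i ∉ S) : ψ i z = 1 := by
    have hi' : ∀ s t, Commute (ψ i s) (ψ i t) := by simpa [S] using hi
    have hle : commutator T ≤ (ψ i).ker := by
      refine Subgroup.commutator_le.2 fun s _ t _ => ?_
      rw [MonoidHom.mem_ker, map_commutatorElement]
      exact commutatorElement_eq_one_iff_mul_comm.2 (hi' s t)
    exact hle hz
  have hprod := hrel (fun i => ζ (Multiplicative.ofAdd (v i))) ⟨Multiplicative.ofAdd v, hv, rfl⟩
  have heq : (L.map fun i => ψ i (ζ (Multiplicative.ofAdd (v i)))) = L.map fun i => ψ i z := by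
    refine List.map_congr_left fun i _ => ?_
    have hpow (c : ZMod p) : ψ i (ζ (Multiplicative.ofAdd c)) = ψ i z ^ c.val := by
      simp [ζ]
    rw [hpow]
    by_cases hi : i ∈ S
    · have := Fact.mk (Fact.out : p.Prime).one_lt
      rw [hv1 i hi, ZMod.val_one, pow_one]
    · rw [hψz i hi, one_pow]
  rw [heq, hdiag] at hprod
  have hz1 : z = 1 := Subtype.ext hprod
  rw [hz1, orderOf_one] at hzp
  exact (Fact.out : p.Prime).one_lt.ne hzp

/-- Corollary 1: a finitely generated nilpotent group whose torsion subgroup is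
nonabelian (i.e. having two non-commuting elements of finite order) is not strongly
verbally closed. -/
theorem fg_nilpotent_nonabelian_torsion_not_svc (G : Type u) [Group G]
    [Group.FG G] [Group.IsNilpotent G]
    (h : ∃ x y : G, IsOfFinOrder x ∧ IsOfFinOrder y ∧ x * y ≠ y * x) :
    ¬ IsStronglyVerballyClosed G := by
  obtain ⟨x, y, hx, hy, hxy⟩ := h
  have hfin := Group.IsNilpotent.finite_setOf_isOfFinOrder G
  let T := Subgroup.closure {g : G | IsOfFinOrder g}
  have hTn : T.Normal := by
    have hle (g : G) : T ≤ T.comap (MulAut.conj g).toMonoidHom :=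
      (Subgroup.closure_le _).2 fun t (ht : IsOfFinOrder t) =>
        Subgroup.subset_closure ((MulAut.conj g).toMonoidHom.isOfFinOrder ht)
    exact ⟨fun t ht g => hle g ht⟩
  have hT : Finite T := Subgroup.finite_closure_of_isOfFinOrder hfin fun _ hg => hg
  have hne : ⁅T, T⁆ ≠ ⊥ := fun hbot => by
    have hmem := Subgroup.commutator_mem_commutator
      (Subgroup.subset_closure hx : x ∈ T) (Subgroup.subset_closure hy : y ∈ T)
    rw [hbot, Subgroup.mem_bot, commutatorElement_eq_one_iff_mul_comm] at hmem
    exact hxy hmem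
  let M := ⁅T, T⁆ ⊓ Subgroup.center G
  have hMT : M ≤ T := inf_le_left.trans (Subgroup.commutator_le_left T T)
  have hM : Finite M := Finite.of_injective _ (Subgroup.inclusion_injective hMT)
  have hcard : Nat.card M ≠ 1 := fun h1 =>
    Subgroup.Normal.inf_center_ne_bot hne (Subgroup.card_eq_one.1 h1)
  obtain ⟨p, hp, hdvd⟩ := Nat.exists_prime_and_dvd hcard
  have := Fact.mk hp
  obtain ⟨z, hz⟩ := exists_prime_orderOf_dvd_card' p hdvd
  refine not_isStronglyVerballyClosed_of_central hfin T p (Subgroup.inclusion hMT z) ?_ z.2.2 ?_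
  · have hz1 : (z : G) ∈ ⁅T, T⁆ := z.2.1
    rw [← Subgroup.map_subtype_commutator] at hz1
    obtain ⟨t, ht, htz⟩ := hz1
    rwa [show Subgroup.inclusion hMT z = t from Subtype.ext htz.symm]
  · rw [orderOf_injective _ (Subgroup.inclusion_injective hMT), hz]
end

section
/- A finite group whose center is not a direct factor (i.e., there is no normal subgroup D with D ∩ Z(G) = {1} and D·Z(G) = G) is not strongly verbally closed. -/
universe u

/-- Two combinatorial lines with two common points are equal. -/
lemma Combinatorics.Line.eq_of_two_common_points {α ι : Type*} {l m : Combinatorics.Line α ι}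
    {a₁ a₂ b₁ b₂ : α} (ha : a₁ ≠ a₂) (h₁ : l a₁ = m b₁) (h₂ : l a₂ = m b₂) : l = m := by
  have hb : b₁ ≠ b₂ := by
    rintro rfl
    obtain ⟨i, hi⟩ := l.proper
    have := congrFun (h₁.trans h₂.symm) i
    simp [hi, ha] at this
  ext i : 2
  have e₁ := congrFun h₁ i
  have e₂ := congrFun h₂ i
  cases hl : l.idxFun i <;> cases hm : m.idxFun i <;> simp_all

lemma Combinatorics.Line.apply_injective {α ι : Type*} (l : Combinatorics.Line α ι) :
    Function.Injective (fun a => l a) := by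
  intro a b hab
  obtain ⟨i, hi⟩ := l.proper
  simpa [hi] using congrFun hab i

/-- A line with more points than there are lines in `S` has a point on no other line of `S`. -/
lemma Combinatorics.Line.exists_private_point {α ι : Type*} [Fintype α]
    (S : Finset (Combinatorics.Line α ι)) (hS : S.card < Fintype.card α)
    (l : Combinatorics.Line α ι) : ∃ a, ∀ m ∈ S, ∀ b, l a = m b → l = m := by
  by_contra! hcon
  choose f hfS b hb hne using hcon
  obtain ⟨a₁, -, a₂, -, ha, hf⟩ := Finset.exists_ne_map_eq_of_card_lt_of_maps_to
    (s := Finset.univ) (t := S) (f := f) hS (fun a _ => hfS a)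
  refine hne a₁ (eq_of_two_common_points (b₂ := b a₂) ha (hb a₁) ?_)
  exact (hb a₂).trans (by rw [hf])

/-- In some finite power of a finite abelian group `A` there is a subgroup all of whose elements
have a trivial coordinate, but which contains, for all `z` and any `k` coordinates, a vector of
powers of `z` which equals `z` at these coordinates. -/
lemma exists_subgroup_pi_with_trivial_coordinates (A : Type*) [CommGroup A] [Finite A] (k : ℕ) :
    ∃ (I : Type) (_ : Finite I) (N : Subgroup (I → A)),
      (∀ x ∈ N, ∃ i, x i = 1) ∧
      ∀ (z : A) (S : Finset I), S.card ≤ k →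
        ∃ e : I → ℕ, (∀ i ∈ S, e i = 1) ∧ (fun i => z ^ e i) ∈ N := by
  classical
  let α := Fin (Nat.card A * (k + 1))
  obtain ⟨ι, _, hι⟩ := Combinatorics.Line.exists_mono_in_high_dimension α A
  let Φ : ((ι → α) → A) →* (Combinatorics.Line α ι → A) :=
    { toFun := fun c l => ∏ a, c (l a)
      map_one' := by ext; simp
      map_mul' := fun c d => by ext; simp [Finset.prod_mul_distrib] }
  refine ⟨Combinatorics.Line α ι, ?_, Φ.range, ?_, ?_⟩
  · exact Finite.of_injective (fun l => l.idxFun) fun l m h => Combinatorics.Line.ext h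
  · rintro _ ⟨c, rfl⟩
    obtain ⟨l, v, hv⟩ := hι c
    refine ⟨l, ?_⟩
    change ∏ a, c (l a) = 1
    simp [hv, α, pow_mul]
  · intro z S hS
    have hcard : S.card < Fintype.card α := by
      have : 0 < Nat.card A := Nat.card_pos
      simp only [α, Fintype.card_fin]
      nlinarith
    choose p hp using Combinatorics.Line.exists_private_point S hcard
    let c : (ι → α) → ℕ := fun x => if ∃ l ∈ S, x = l (p l) then 1 else 0
    refine ⟨fun l => ∑ a, c (l a), fun l hl => ?_, fun x => z ^ c x, ?_⟩
    · change ∑ a, c (l a) = 1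
      rw [Finset.sum_eq_single (p l)]
      · exact if_pos ⟨l, hl, rfl⟩
      · intro a _ ha
        refine if_neg ?_
        rintro ⟨m, hm, hma⟩
        obtain rfl := hp m l hl a hma.symm
        exact ha (m.apply_injective hma)
      · simp
    · ext l
      exact Finset.prod_pow_eq_pow_sum Finset.univ (fun a => c (l a)) z

open scoped IsMulCommutative in
/-- If every central element is fixed by some homomorphism to the center, then a single
homomorphism fixes any given finite set of central elements. -/
lemma exists_hom_center_fixing_finset {G : Type*} [Group G]
    (h : ∀ z : Subgroup.center G, ∃ φ : G →* Subgroup.center G, φ z = z)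
    (T : Finset (Subgroup.center G)) :
    ∃ φ : G →* Subgroup.center G, ∀ z ∈ T, φ z = z := by
  classical
  induction T using Finset.induction_on with
  | empty => exact ⟨1, by simp⟩
  | insert w T _ ih =>
    obtain ⟨φ, hφ⟩ := ih
    obtain ⟨ψ, hψ⟩ := h (w * (φ w)⁻¹)
    refine ⟨φ * ψ * (ψ.comp ((Subgroup.center G).subtype.comp φ))⁻¹, fun z hz => ?_⟩
    rcases Finset.mem_insert.1 hz with rfl | hz
    · simp only [Subgroup.coe_mul, InvMemClass.coe_inv, map_mul, map_inv] at hψ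
      simp only [MonoidHom.mul_apply, MonoidHom.inv_apply, MonoidHom.comp_apply,
        Subgroup.subtype_apply]
      rw [mul_assoc, hψ]
      simp
    · simp [hφ z hz]

/-- If the center of a finite group is not a direct factor, then some central element is fixed by
no homomorphism to the center. -/
lemma exists_center_not_fixed {G : Type*} [Group G] [Finite G]
    (h : ¬ ∃ D : Subgroup G, D.Normal ∧ D ⊓ Subgroup.center G = ⊥ ∧
        ∀ g : G, ∃ d ∈ D, ∃ z ∈ Subgroup.center G, g = d * z) :
    ∃ z : Subgroup.center G, ∀ φ : G →* Subgroup.center G, φ z ≠ z := by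
  by_contra! hcon
  cases nonempty_fintype (Subgroup.center G)
  obtain ⟨φ, hφ⟩ := exists_hom_center_fixing_finset hcon Finset.univ
  refine h ⟨φ.ker, inferInstance, ?_, fun g => ⟨g * (φ g : G)⁻¹, ?_, φ g, (φ g).2, by simp⟩⟩
  · refine (Subgroup.eq_bot_iff_forall _).2 fun x ⟨hx, hxc⟩ => ?_
    have := hφ ⟨x, hxc⟩ (Finset.mem_univ _)
    rw [MonoidHom.mem_ker.1 hx] at this
    exact (congrArg Subtype.val this).symm
  · rw [MonoidHom.mem_ker, map_mul, map_inv, hφ (φ g) (Finset.mem_univ _), mul_inv_cancel]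

/-- A subgroup that is algebraically closed in a finite group is a retract. -/
lemma Subgroup.IsAlgebraicallyClosedIn.exists_retraction {G : Type*} [Group G] [Finite G]
    {H : Subgroup G} (hH : H.IsAlgebraicallyClosedIn) :
    ∃ ρ : G →* H, ∀ x : H, ρ x = x := by
  obtain ⟨n, ⟨e⟩⟩ := Finite.exists_equiv_fin G
  obtain ⟨m, ⟨s⟩⟩ := Finite.exists_equiv_fin ((G × G) ⊕ H)
  let X : G → Monoid.Coprod H (FreeGroup (Fin n)) := fun g =>
    Monoid.Coprod.inr (FreeGroup.of (e g))
  let W : (G × G) ⊕ H → Monoid.Coprod H (FreeGroup (Fin n)) :=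
    Sum.elim (fun p => X p.1 * X p.2 * (X (p.1 * p.2))⁻¹)
      (fun x => X x * (Monoid.Coprod.inl x)⁻¹)
  obtain ⟨f, hf⟩ := hH n m (fun i => W (s.symm i)) ⟨fun i => e.symm i, fun i => by
    rcases s.symm i with p | x <;> simp [W, X]⟩
  have hmul (a b : G) : f (e a) * f (e b) = f (e (a * b)) := by
    have := hf (s (.inl (a, b)))
    simpa [W, X, mul_inv_eq_one] using this
  have hid (x : H) : f (e x) = x := by
    have := hf (s (.inr x))
    simpa [W, X, mul_inv_eq_one] using this
  exact ⟨MonoidHom.mk' (fun g => f (e g)) fun a b => (hmul a b).symm, hid⟩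

lemma MonoidHom.map_mem_center_of_surjective {G K : Type*} [Group G] [Group K] {f : G →* K}
    (hf : Function.Surjective f) {x : G} (hx : x ∈ Subgroup.center G) :
    f x ∈ Subgroup.center K := by
  rw [Subgroup.mem_center_iff] at hx ⊢
  intro y
  obtain ⟨y, rfl⟩ := hf y
  rw [← map_mul, hx, map_mul]

/-- For a homomorphism from a power that retracts the diagonal, the number of coordinates
with noncentral image is at most the order of the group. -/
lemma exists_finset_noncentral_coordinates {G I : Type*} [Group G] [Finite G] [Finite I]
    [DecidableEq I] (Φ : (I → G) →* G) (hΦ : ∀ g, Φ (fun _ => g) = g) :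
    ∃ S : Finset I, S.card ≤ Nat.card G ∧
      ∀ i ∉ S, ∀ g, Φ (Pi.mulSingle i g) ∈ Subgroup.center G := by
  classical
  cases nonempty_fintype I
  cases nonempty_fintype G
  have hcomm {i j : I} (hij : i ≠ j) (x y : G) :
      Commute (Φ (Pi.mulSingle i x)) (Φ (Pi.mulSingle j y)) :=
    (Pi.mulSingle_commute hij x y).map Φ
  have hcentral {i j : I} (hij : i ≠ j) {x y : G}
      (hxy : Φ (Pi.mulSingle i x) = Φ (Pi.mulSingle j y)) :
      Φ (Pi.mulSingle i x) ∈ Subgroup.center G := by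
    rw [Subgroup.mem_center_iff]
    intro g
    have hg : Pi.mulSingle i g * Function.update (fun _ : I => g) i 1 = fun _ => g := by
      ext k
      by_cases hk : k = i
      · subst hk; simp
      · simp [hk]
    have h₁ : Commute (Φ (Pi.mulSingle i x)) (Φ (Pi.mulSingle i g)) := by
      rw [hxy]
      exact hcomm hij.symm y g
    have h₂ : Commute (Φ (Pi.mulSingle i x)) (Φ (Function.update (fun _ : I => g) i 1)) := by
      refine Commute.map ?_ Φ
      ext k
      by_cases hk : k = i
      · subst hk; simp
      · simp [hk]
    have := h₁.mul_right h₂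
    rw [← map_mul, hg, hΦ] at this
    exact this.eq.symm
  let S : Finset I := {i | ∃ g, Φ (Pi.mulSingle i g) ∉ Subgroup.center G}
  have hS : ∀ i : S, ∃ g, Φ (Pi.mulSingle i.1 g) ∉ Subgroup.center G := fun i =>
    (Finset.mem_filter.1 i.2).2
  choose x hx using hS
  refine ⟨S, ?_, fun i hi g => ?_⟩
  · have hinj : Function.Injective fun i : S => Φ (Pi.mulSingle i.1 (x i)) := by
      intro i k hik
      by_contra hne
      exact hx i (hcentral (fun h => hne (Subtype.ext h)) hik)
    simpa using Nat.card_le_card_of_injective _ hinj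
  · by_contra hg
    exact hi (Finset.mem_filter.2 ⟨Finset.mem_univ _, g, hg⟩)

open scoped IsMulCommutative in
/-- A homomorphism from a power to the group that retracts the diagonal and kills a vector of
powers of a central element `z`, with exponent `1` at every noncentral coordinate, gives rise to
a homomorphism to the center fixing `z`. -/
lemma exists_hom_center_fixing {G I : Type*} [Group G] [Finite I] [DecidableEq I]
    (Φ : (I → G) →* G) (hΦ : ∀ g, Φ (fun _ => g) = g) (S : Finset I)
    (hS : ∀ i ∉ S, ∀ g, Φ (Pi.mulSingle i g) ∈ Subgroup.center G)
    (z : Subgroup.center G) (e : I → ℕ) (he : ∀ i ∈ S, e i = 1)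
    (hker : Φ (fun i => (z : G) ^ e i) = 1) :
    ∃ φ : G →* Subgroup.center G, φ z = z := by
  classical
  cases nonempty_fintype I
  have hcen (g : I → Subgroup.center G) : Φ (fun i => (g i : G)) ∈ Subgroup.center G := by
    refine MonoidHom.map_mem_center_of_surjective (fun y => ⟨fun _ => y, hΦ y⟩) ?_
    rw [Subgroup.mem_center_iff]
    intro y
    ext i
    exact Subgroup.mem_center_iff.1 (g i).2 (y i)
  let Ψ : (I → Subgroup.center G) →* Subgroup.center G :=
    MonoidHom.mk' (fun g => ⟨Φ (fun i => (g i : G)), hcen g⟩) fun a b =>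
      Subtype.ext (Φ.map_mul (fun i => (a i : G)) (fun i => (b i : G)))
  let φ : I → G →* Subgroup.center G := fun i =>
    if hi : i ∈ S then 1 else
      (Φ.comp (MonoidHom.mulSingle (fun _ : I => G) i)).codRestrict _ (hS i hi)
  have hφ (i : I) : φ i z ^ (1 - e i : ℤ) = Ψ (Pi.mulSingle i (z ^ (1 - e i : ℤ))) := by
    by_cases hi : i ∈ S
    · simp [he i hi]
    · rw [← map_zpow]
      simp only [φ, dif_neg hi, ← Subgroup.coe_zpow]
      refine Subtype.ext (congrArg Φ (funext fun k => ?_))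
      exact (Pi.apply_mulSingle (fun _ : I => ((↑) : Subgroup.center G → G)) (fun _ => rfl) i _
        k).symm
  refine ⟨∏ i, φ i ^ (1 - e i : ℤ), ?_⟩
  have h₁ : (∏ i, φ i ^ (1 - e i : ℤ)) (z : G) = Ψ (fun i => z ^ (1 - e i : ℤ)) := by
    rw [← Finset.univ_prod_mulSingle (fun i => z ^ (1 - e i : ℤ)), map_prod,
      MonoidHom.finsetProd_apply]
    exact Finset.prod_congr rfl fun i _ => hφ i
  have h₂ : (fun i => z ^ (1 - e i : ℤ)) = (fun _ => z) * (fun i => z ^ e i)⁻¹ := by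
    ext i
    simp [zpow_sub]
  have h₃ : Ψ (fun i => z ^ e i) = 1 := Subtype.ext (by simpa [Ψ] using hker)
  rw [h₁, h₂, map_mul, map_inv, h₃, inv_one, mul_one]
  exact Subtype.ext (hΦ z)

/-- If every vector of the normal subgroup `N` of a power of `G` has a trivial coordinate, then
the image of the diagonal in the quotient by `N` is verbally closed. -/
lemma isVerballyClosed_range_diagonal {G I : Type*} [Group G] (N : Subgroup (I → G)) [N.Normal]
    (hN : ∀ x ∈ N, ∃ i, x i = 1) :
    ((QuotientGroup.mk' N).comp (Pi.constMonoidHom I G)).range.IsVerballyClosed := by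
  rintro n w _ ⟨a, rfl⟩ ⟨f, hf⟩
  choose F hF using fun j => QuotientGroup.mk'_surjective N (f j)
  have hlift : QuotientGroup.mk' N (FreeGroup.lift F w) = FreeGroup.lift f w := by
    rw [← MonoidHom.comp_apply]
    congr 1
    ext j
    simpa using hF j
  rw [← hlift, MonoidHom.comp_apply, eq_comm, QuotientGroup.mk'_eq_mk'] at hf
  obtain ⟨ν, hν, hf⟩ := hf
  obtain ⟨i, hi⟩ := hN ν hν
  have hsol : FreeGroup.lift (fun j => F j i) w = a := by
    have h₁ : FreeGroup.lift (fun j => F j i) w = FreeGroup.lift F w i := by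
      change _ = ((Pi.evalMonoidHom (fun _ : I => G) i).comp (FreeGroup.lift F)) w
      congr 1
      ext j
      simp
    rw [h₁, ← hf]
    simp [hi]
  refine ⟨fun j => ((QuotientGroup.mk' N).comp (Pi.constMonoidHom I G)) (F j i),
    fun j => ⟨_, rfl⟩, ?_⟩
  rw [← hsol, ← MonoidHom.comp_apply]
  congr 1
  ext j
  simp

/-- Corollary 2: a finite group whose center is not a direct factor is not strongly
verbally closed. -/
theorem not_svc_of_center_not_direct_factor (G : Type u) [Group G] [Finite G]
    (h : ¬ ∃ D : Subgroup G, D.Normal ∧ D ⊓ Subgroup.center G = ⊥ ∧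
        ∀ g : G, ∃ d ∈ D, ∃ z ∈ Subgroup.center G, g = d * z) :
    ¬ IsStronglyVerballyClosed G := by
  classical
  intro hsvc
  obtain ⟨z, hz⟩ := exists_center_not_fixed h
  open scoped IsMulCommutative in
  obtain ⟨I, _, N, hN, hNz⟩ :=
    exists_subgroup_pi_with_trivial_coordinates (Subgroup.center G) (Nat.card G)
  let j : (I → Subgroup.center G) →* (I → G) :=
    MonoidHom.piMap fun _ => (Subgroup.center G).subtype
  let M := N.map j
  have hM : ∀ x ∈ M, ∃ i, x i = 1 := by
    rintro _ ⟨x, hx, rfl⟩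
    obtain ⟨i, hi⟩ := hN x hx
    exact ⟨i, by simp [j, hi]⟩
  have : M.Normal := by
    constructor
    rintro _ ⟨x, hx, rfl⟩ g
    have : g * j x * g⁻¹ = j x := by
      rw [mul_inv_eq_iff_eq_mul]
      ext i
      exact Subgroup.mem_center_iff.1 (x i).2 (g i)
    rw [this]
    exact ⟨x, hx, rfl⟩
  let δ : G →* (I → G) ⧸ M := (QuotientGroup.mk' M).comp (Pi.constMonoidHom I G)
  have hδ : Function.Injective δ := by
    refine (injective_iff_map_eq_one δ).2 fun a ha => ?_
    obtain ⟨i, hi⟩ := hM _ ((QuotientGroup.eq_one_iff _).1 ha)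
    exact hi
  obtain ⟨ρ, hρ⟩ :=
    (hsvc _ δ hδ (isVerballyClosed_range_diagonal M hM)).exists_retraction
  let Φ : (I → G) →* G :=
    ((MonoidHom.ofInjective hδ).symm.toMonoidHom.comp ρ).comp (QuotientGroup.mk' M)
  have hΦ (g : G) : Φ (fun _ => g) = g := by
    change (MonoidHom.ofInjective hδ).symm (ρ (δ g)) = g
    rw [MulEquiv.symm_apply_eq]
    exact hρ ⟨δ g, g, rfl⟩
  obtain ⟨S, hScard, hS⟩ := exists_finset_noncentral_coordinates Φ hΦ
  obtain ⟨e, he, heN⟩ := hNz z S hScard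
  obtain ⟨φ, hφ⟩ := exists_hom_center_fixing Φ hΦ S hS z e he (by
    have hmem : (fun i => (z : G) ^ e i) ∈ M := ⟨_, heN, by ext; simp [j]⟩
    have : QuotientGroup.mk' M (fun i => (z : G) ^ e i) = 1 :=
      (QuotientGroup.eq_one_iff _).2 hmem
    simp only [Φ, MonoidHom.comp_apply, this, map_one])
  exact hz φ hφ
end

section
/- Let p be a prime and C a finite elementary abelian p-group. For every k ∈ ℕ there exists t ≥ k such that the direct product P = C_1 × ⋯ × C_t of t copies C_i of C contains a subgroup R, invariant with respect to the diagonal action on P of the endomorphism algebra End(C), with the following properties: (1) R ⊆ ⋃_{j=1}^t ker ρ_j, where ρ_j : P → C_j are the natural coordinate projections; (2) R · (×_{j∉J} C_j) = P for every subset J ⊆ {1,…,t} of cardinality |J| = k; (3) moreover, each such J is contained in a set J' ⊇ J such that P = R × (×_{j∉J'} C_j) (internal direct product), and there exist integers n_{ij} ∈ ℤ such that the projection π : P → ×_{j∉J'} C_j with kernel R acts by π(c_i) = ∏_{j∉J'} c_j^{n_{ij}} for c_i ∈ C_i, where c_j ∈ C_j denotes the element corresponding to c_i under the isomorphisms C_i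 ≅ C ≅ C_j. -/
universe u

namespace MvPolynomial

theorem IsHomogeneous.eval_smul {σ K : Type*} [Fintype σ] [CommSemiring K] {P : MvPolynomial σ K}
    {d : ℕ} (hP : P.IsHomogeneous d) (a : K) (v : σ → K) :
    eval (a • v) P = a ^ d * eval v P := by
  simp only [eval_eq', Finset.mul_sum]
  refine Finset.sum_congr rfl fun m hm ↦ ?_
  have hd : ∑ i, m i = d := by
    rw [← Finsupp.degree_eq_sum, ← not_imp_comm.1 hP.coeff_eq_zero (mem_support_iff.1 hm)]
  simp only [Pi.smul_apply, smul_eq_mul, mul_pow, Finset.prod_mul_distrib,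
    Finset.prod_pow_eq_pow_sum, hd]
  ring

theorem exists_isHomogeneous_one_eval_eq {σ K : Type*} [Fintype σ] [CommSemiring K]
    (f : (σ → K) →ₗ[K] K) :
    ∃ P : MvPolynomial σ K, P.IsHomogeneous 1 ∧ ∀ v, eval v P = f v := by
  classical
  refine ⟨∑ i, C (f (Pi.single i 1)) * X i,
    IsHomogeneous.sum _ _ _ fun i _ ↦ isHomogeneous_C_mul_X _ _, fun v ↦ ?_⟩
  rw [LinearMap.pi_apply_eq_sum_univ f v]
  simp only [map_sum, map_mul, eval_C, eval_X, smul_eq_mul]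
  refine Finset.sum_congr rfl fun i _ ↦ ?_
  rw [mul_comm]
  congr 2
  ext j
  simp [Pi.single_apply, eq_comm]

/-- Finitely many homogeneous polynomials of positive degree in sufficiently many variables over a
finite field have a nontrivial common zero. -/
theorem exists_ne_zero_forall_eval_eq_zero {σ K α : Type*} [Fintype σ] [Field K] [Finite K]
    [Fintype α] {d : ℕ} (hd : d ≠ 0) (hcard : Fintype.card α * d < Fintype.card σ)
    (P : α → MvPolynomial σ K) (hP : ∀ a, (P a).IsHomogeneous d) :
    ∃ v : σ → K, v ≠ 0 ∧ ∀ a, eval v (P a) = 0 := by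
  classical
  have := Fintype.ofFinite K
  obtain ⟨p, hchar⟩ := CharP.exists K
  have hp := CharP.char_is_prime K p
  have hsum : ∑ a, (P a).totalDegree < Fintype.card σ := by
    refine lt_of_le_of_lt (Finset.sum_le_card_nsmul _ _ d fun a _ ↦ (hP a).totalDegree_le) ?_
    simpa using hcard
  have hdvd := char_dvd_card_solutions_of_fintype_sum_lt p hsum
  have hzero (a : α) : eval 0 (P a) = 0 := by
    have := (hP a).eval_smul 0 0
    simpa [hd] using this
  have hpos : 0 < Fintype.card {x : σ → K // ∀ a, eval x (P a) = 0} :=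
    Fintype.card_pos_iff.2 ⟨⟨0, hzero⟩⟩
  have hlt := hp.one_lt.trans_le (Nat.le_of_dvd hpos hdvd)
  obtain ⟨⟨v, hv⟩, hne⟩ := Fintype.exists_ne_of_one_lt_card hlt ⟨0, hzero⟩
  exact ⟨v, fun h ↦ hne (Subtype.ext h), hv⟩

end MvPolynomial

open MvPolynomial in
/-- Evaluating homogeneous polynomials of degree `k + 1` at all points of a projective space of
large dimension gives a code in which any family of codewords indexed by `α` has a common zero,
while any `k` coordinates are independent. -/
theorem exists_code_common_zero (K α : Type*) [Field K] [Finite K] [Finite α] (k : ℕ) :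
    ∃ t : ℕ, k ≤ t ∧ ∃ W : Submodule K (Fin t → K),
      (∀ f : α → Fin t → K, (∀ a, f a ∈ W) → ∃ j, ∀ a, f a j = 0) ∧
      ∀ J : Finset (Fin t), J.card = k → ∀ i ∈ J, ∃ w ∈ W, w i ≠ 0 ∧ ∀ j ∈ J, j ≠ i → w j = 0 := by
  classical
  have := Fintype.ofFinite α
  let m := Fintype.card α * (k + 1) + k + 1
  let V := Fin m → K
  let e := (Finite.equivFin (Projectivization K V)).symm
  let x (j) : V := (e j).rep
  refine ⟨_, ?_, (homogeneousSubmodule (Fin m) K (k + 1)).map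
    (LinearMap.pi fun j ↦ (aeval (R := K) (x j)).toLinearMap), ?_, ?_⟩
  · have hinj : Function.Injective fun i : Fin m ↦
        Projectivization.mk K (Pi.single i 1 : V) (by simp) := by
      intro i j hij
      obtain ⟨a, ha⟩ := (Projectivization.mk_eq_mk_iff' K _ _ _ _).1 hij
      by_contra hne
      have := congrFun ha i
      simp [hne] at this
    have := Nat.card_le_card_of_injective _ hinj
    rw [Nat.card_fin] at this
    exact (by omega : k ≤ m).trans this
  · intro f hf
    choose P hP hPf using fun a ↦ Submodule.mem_map.1 (hf a)
    obtain ⟨v, hv, hzero⟩ := exists_ne_zero_forall_eval_eq_zero (Nat.succ_ne_zero k)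
      (by simp only [Fintype.card_fin, m, Nat.succ_eq_add_one]; omega) P hP
    refine ⟨e.symm (Projectivization.mk K v hv), fun a ↦ ?_⟩
    obtain ⟨c, hc⟩ := Projectivization.exists_smul_eq_mk_rep K v hv
    have hx : x (e.symm (Projectivization.mk K v hv)) = (c : K) • v := by
      simp only [x, Equiv.apply_symm_apply, ← hc]
      rfl
    rw [← hPf a]
    simp only [LinearMap.pi_apply, AlgHom.toLinearMap_apply, hx, aeval_eq_eval,
      (show (P a).IsHomogeneous (k + 1) from hP a).eval_smul, hzero, mul_zero]
  · intro J hJ i hi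
    have hsep (j) : ∃ L : MvPolynomial (Fin m) K, L.IsHomogeneous 1 ∧ eval (x i) L ≠ 0 ∧
        (j ≠ i → eval (x j) L = 0) := by
      by_cases hji : j = i
      · obtain ⟨g, hg, -⟩ := Submodule.exists_le_ker_of_notMem (K := K) (p := ⊥)
          (v := x i) (by simpa using (e i).rep_nonzero)
        obtain ⟨L, hL, hLg⟩ := exists_isHomogeneous_one_eval_eq g
        exact ⟨L, hL, by rwa [hLg], fun h ↦ (h hji).elim⟩
      · have hmem : x i ∉ Submodule.span K {x j} := by
          rw [Submodule.mem_span_singleton]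
          have := Projectivization.linearIndependent_pair_iff_ne.2 (e.injective.ne hji)
          rw [LinearIndependent.pair_iff' (Projectivization.rep_nonzero _)] at this
          rintro ⟨a, ha⟩
          exact this a ha
        obtain ⟨g, hg, hker⟩ := Submodule.exists_le_ker_of_notMem hmem
        obtain ⟨L, hL, hLg⟩ := exists_isHomogeneous_one_eval_eq g
        exact ⟨L, hL, by rwa [hLg], fun _ ↦ by
          rw [hLg]; exact hker (Submodule.mem_span_singleton_self _)⟩
    choose L hL hLi hLj using hsep
    refine ⟨_, Submodule.mem_map_of_mem (p := homogeneousSubmodule (Fin m) K (k + 1))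
      (r := (∏ j ∈ J, L j) * L i) ?_, ?_, ?_⟩
    · have := (IsHomogeneous.prod J L (fun _ ↦ 1) fun j _ ↦ hL j).mul (hL i)
      simpa [hJ] using this
    · simp [Finset.prod_eq_zero_iff, hLi]
    · intro j hj hji
      simp only [LinearMap.pi_apply, AlgHom.toLinearMap_apply, map_mul, map_prod,
        aeval_eq_eval]
      rw [Finset.prod_eq_zero hj (hLj j hji), zero_mul]

/-- Coordinates that are independent on a subspace `W` of `K^ι` extend to an information set `J'`,
and `W` is then the kernel of a projection onto the vectors vanishing on `J'`. -/
theorem exists_informationSet {K ι : Type*} [Field K] [Fintype ι] [DecidableEq ι]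
    (W : Submodule K (ι → K)) (J : Finset ι)
    (hJ : ∀ i ∈ J, ∃ w ∈ W, w i ≠ 0 ∧ ∀ j ∈ J, j ≠ i → w j = 0) :
    ∃ J' : Finset ι, J ⊆ J' ∧ ∃ b : Matrix ι ι K,
      (∀ j ∈ J', ∀ i, b j i = 0) ∧
      (∀ j ∉ J', ∀ i ∉ J', b j i = if j = i then 1 else 0) ∧
      ∀ w, w ∈ W ↔ b.mulVec w = 0 := by
  let e (i : ι) : W →ₗ[K] K := (LinearMap.proj i).comp W.subtype
  have hind : LinearIndepOn K e (J : Set ι) := by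
    rw [linearIndepOn_finset_iff]
    intro c hc i hi
    obtain ⟨w, hw, hwi, hwj⟩ := hJ i hi
    have := LinearMap.congr_fun hc ⟨w, hw⟩
    simp only [LinearMap.sum_apply, LinearMap.smul_apply, LinearMap.zero_apply, e,
      LinearMap.comp_apply, Submodule.subtype_apply, LinearMap.proj_apply, smul_eq_mul] at this
    rw [Finset.sum_eq_single i (fun j hj hji ↦ by rw [hwj j hj hji, mul_zero])
      (fun h ↦ (h hi).elim)] at this
    exact (mul_eq_zero.1 this).resolve_right hwi
  obtain ⟨B, -, hJB, hspan, hB⟩ := exists_linearIndepOn_extension hind (Set.subset_univ _)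
  lift B to Finset ι using B.toFinite
  have hex (i : ι) : ∃ a : ι → K, (∑ j ∈ B, a j • e j = e i) ∧
      (i ∈ B → a = Pi.single i 1) := by
    by_cases hi : i ∈ B
    · refine ⟨Pi.single i 1, ?_, fun _ ↦ rfl⟩
      rw [Finset.sum_eq_single i (fun j _ hji ↦ by simp [hji]) (fun h ↦ (h hi).elim)]
      simp
    · obtain ⟨a, ha⟩ := (Submodule.mem_span_image_finset_iff_exists_fun K).1
        (hspan ⟨i, trivial, rfl⟩)
      refine ⟨fun j ↦ if h : j ∈ B then a ⟨j, h⟩ else 0, ?_, fun h ↦ (hi h).elim⟩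
      rw [← ha, ← Finset.sum_coe_sort]
      simp
  choose a ha haB using hex
  have hmem (w : ι → K) (hw : w ∈ W) (i : ι) : w i = ∑ j ∈ B, a i j * w j := by
    simpa [e] using (LinearMap.congr_fun (ha i) ⟨w, hw⟩).symm
  let b : Matrix ι ι K := fun j i ↦
    if j ∈ B then 0 else (if j = i then 1 else 0) - if i ∈ B then a j i else 0
  have hb (w : ι → K) (j : ι) (hj : j ∉ B) :
      b.mulVec w j = w j - ∑ i ∈ B, a j i * w i := by
    simp [b, Matrix.mulVec, dotProduct, hj, sub_mul, Finset.sum_sub_distrib, ite_mul]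
  refine ⟨B, by exact_mod_cast hJB, b, fun j hj i ↦ by simp [b, hj],
    fun j hj i hi ↦ by simp [b, hj, hi], fun w ↦ ⟨fun hw ↦ ?_, fun hw ↦ ?_⟩⟩
  · ext j
    by_cases hj : j ∈ B
    · simp [b, Matrix.mulVec, dotProduct, hj]
    · rw [hb w j hj, ← hmem w hw j, sub_self, Pi.zero_apply]
  · have hw' (i : ι) : w i = ∑ j ∈ B, a i j * w j := by
      by_cases hi : i ∈ B
      · simp [haB i hi, Pi.single_apply, hi]
      · exact sub_eq_zero.1 ((hb w i hi).symm.trans (congrFun hw i))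
    by_contra hnot
    obtain ⟨φ, hφw, hφ⟩ := Submodule.exists_le_ker_of_notMem hnot
    let c (j : ι) : K := ∑ i, φ (Pi.single i 1) * a i j
    have hφc (u : ι → K) (hu : ∀ i, u i = ∑ j ∈ B, a i j * u j) :
        φ u = ∑ j ∈ B, c j * u j := by
      have hφu : φ u = ∑ i, u i * φ (Pi.single i 1) := by
        conv_lhs => rw [pi_eq_sum_univ' u]
        simp [map_sum]
      rw [hφu]
      simp only [c, Finset.sum_mul]
      rw [Finset.sum_comm]
      refine Finset.sum_congr rfl fun i _ ↦ ?_
      rw [hu i, Finset.sum_mul]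
      exact Finset.sum_congr rfl fun j _ ↦ by ring
    have hc : ∑ j ∈ B, c j • e j = 0 := by
      ext ⟨u, hu⟩
      have := hφc u (hmem u hu)
      rw [LinearMap.mem_ker.1 (hφ hu)] at this
      simpa [e] using this.symm
    have hc0 := linearIndepOn_finset_iff.1 hB c hc
    exact hφw ((hφc w hw').trans (Finset.sum_eq_zero fun j hj ↦ by rw [hc0 j hj, zero_mul]))

/-- The approximation lemma: let `C` be a finite elementary abelian `p`-group. For any
`k` there is `t ≥ k` such that the direct product `P = C^t` contains a subgroup `R`,
invariant under the diagonal action of `End C`, such that: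
1) `R` is contained in the union of the kernels of the coordinate projections;
2) `R · (×_{j∉J} C_j) = P` for every `J ⊆ {1,…,t}` with `|J| = k`;
3) moreover each such `J` is contained in some `J' ⊇ J` with `P = R × (×_{j∉J'} C_j)`
   (witnessed by the projection `π` onto `×_{j∉J'} C_j` with kernel `R`), and there are
   integers `n i j` such that `π` maps the element of `C_i` corresponding to `c ∈ C` to
   `∏_{j∉J'} c_j ^ (n i j)`, where `c_j ∈ C_j` corresponds to `c`. -/
theorem approximation_lemma (p : ℕ) (hp : p.Prime) (C : Type u) [CommGroup C]
    [Finite C] (hC : ∀ c : C, c ≠ 1 → orderOf c = p) (k : ℕ) :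
    ∃ t : ℕ, k ≤ t ∧ ∃ R : Subgroup (Fin t → C),
      (∀ φ : C →* C, ∀ r ∈ R, (fun i => φ (r i)) ∈ R) ∧
      (∀ r ∈ R, ∃ j : Fin t, r j = 1) ∧
      (∀ J : Finset (Fin t), J.card = k →
        ∀ g : Fin t → C, ∃ r ∈ R, ∃ s : Fin t → C,
          (∀ j ∈ J, s j = 1) ∧ g = r * s) ∧
      (∀ J : Finset (Fin t), J.card = k → ∃ J' : Finset (Fin t), J ⊆ J' ∧
        ∃ π : (Fin t → C) →* (Fin t → C),
          (∀ (g : Fin t → C) (j : Fin t), j ∈ J' → π g j = 1) ∧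
          (∀ s : Fin t → C, (∀ j ∈ J', s j = 1) → π s = s) ∧
          π.ker = R ∧
          ∃ N : Fin t → Fin t → ℤ, ∀ (i : Fin t) (c : C),
            π (Pi.mulSingle i c) = fun j => if j ∈ J' then 1 else c ^ (N i j)) := by
  classical
  have : Fact p.Prime := ⟨hp⟩
  have hpow (x : Additive C) : p • x = 0 := by
    by_cases hx : x.toMul = 1
    · rw [toMul_eq_one.1 hx, smul_zero]
    · exact congrArg Additive.ofMul (hC _ hx ▸ pow_orderOf_eq_one x.toMul)
  obtain ⟨_⟩ : Nonempty (Module (ZMod p) (Additive C)) := ⟨AddCommGroup.zmodModule hpow⟩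
  have : Finite (Module.Dual (ZMod p) (Additive C)) := DFunLike.finite _
  obtain ⟨t, hkt, W, hzero, hindep⟩ :=
    exists_code_common_zero (ZMod p) (Module.Dual (ZMod p) (Additive C)) k
  let R : Subgroup (Fin t → C) :=
    { carrier := {r | ∀ f : Module.Dual (ZMod p) (Additive C),
        (fun i ↦ f (Additive.ofMul (r i))) ∈ W}
      mul_mem' := fun hr hs f ↦ by simpa [Pi.add_def] using W.add_mem (hr f) (hs f)
      one_mem' := fun f ↦ by simp [← Pi.zero_def]
      inv_mem' := fun hr f ↦ by simpa [Pi.neg_def] using W.neg_mem (hr f) }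
  have hproj (J : Finset (Fin t)) (hJ : J.card = k) : ∃ J' : Finset (Fin t), J ⊆ J' ∧
        ∃ π : (Fin t → C) →* (Fin t → C),
          (∀ (g : Fin t → C) (j : Fin t), j ∈ J' → π g j = 1) ∧
          (∀ s : Fin t → C, (∀ j ∈ J', s j = 1) → π s = s) ∧
          π.ker = R ∧
          ∃ N : Fin t → Fin t → ℤ, ∀ (i : Fin t) (c : C),
            π (Pi.mulSingle i c) = fun j => if j ∈ J' then 1 else c ^ (N i j) := by
    obtain ⟨J', hJJ', b, hb0, hb1, hbW⟩ := exists_informationSet W J (hindep J hJ)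
    let π : (Fin t → C) →* (Fin t → C) :=
      { toFun := fun g j ↦ (∑ i, b j i • Additive.ofMul (g i)).toMul
        map_one' := by ext j; simp
        map_mul' := fun g h ↦ by ext j; simp [smul_add, Finset.sum_add_distrib] }
    have hπ (g : Fin t → C) (j : Fin t) :
        Additive.ofMul (π g j) = ∑ i, b j i • Additive.ofMul (g i) := rfl
    have hπ0 (g : Fin t → C) (j : Fin t) (hj : j ∈ J') : π g j = 1 := by
      rw [← ofMul_eq_zero, hπ]
      exact Finset.sum_eq_zero fun i _ ↦ by rw [hb0 j hj, zero_smul]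
    refine ⟨J', hJJ', π, hπ0, fun s hs ↦ ?_, ?_, fun i j ↦ ((b j i).val : ℤ), fun i c ↦ ?_⟩
    · ext j
      by_cases hj : j ∈ J'
      · rw [hπ0 s j hj, hs j hj]
      · apply Additive.ofMul.injective
        rw [hπ, Finset.sum_eq_single j]
        · simp [hb1 j hj j hj]
        · intro i _ hij
          by_cases hi : i ∈ J'
          · simp [hs i hi]
          · simp [hb1 j hj i hi, hij.symm]
        · simp
    · ext g
      have hg (f : Module.Dual (ZMod p) (Additive C)) (j : Fin t) :
          f (Additive.ofMul (π g j)) =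
            b.mulVec (fun i ↦ f (Additive.ofMul (g i))) j := by
        simp [hπ, map_sum, Matrix.mulVec, dotProduct]
      change π g = 1 ↔ ∀ f : Module.Dual (ZMod p) (Additive C), _ ∈ W
      simp only [hbW]
      constructor
      · intro h f
        ext j
        rw [← hg, h]
        simp
      · intro h
        ext j
        rw [Pi.one_apply, ← ofMul_eq_zero,
          ← Module.forall_dual_apply_eq_zero_iff (ZMod p) (Additive.ofMul (π g j))]
        intro f
        rw [hg, h f, Pi.zero_apply]
    · ext j
      split_ifs with hj
      · exact hπ0 _ j hj
      · apply Additive.ofMul.injective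
        rw [hπ, Finset.sum_eq_single i]
        · rw [Pi.mulSingle_eq_same, zpow_natCast, ofMul_pow,
            ← Nat.cast_smul_eq_nsmul (ZMod p), ZMod.natCast_zmod_val]
        · intro l _ hl
          simp [Pi.mulSingle_eq_of_ne hl]
        · simp
  refine ⟨t, hkt, R, fun φ r hr f ↦ ?_, fun r hr ↦ ?_, fun J hJ g ↦ ?_, hproj⟩
  · exact hr (f.comp (φ.toAdditive.toZModLinearMap p))
  · obtain ⟨j, hj⟩ := hzero _ hr
    exact ⟨j, ofMul_eq_zero.1 ((Module.forall_dual_apply_eq_zero_iff (ZMod p) _).1 hj)⟩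
  · obtain ⟨J', hJJ', π, hπ0, hπs, hker, -⟩ := hproj J hJ
    refine ⟨g * (π g)⁻¹, ?_, π g, fun j hj ↦ hπ0 g j (hJJ' hj), by simp⟩
    rw [← hker, MonoidHom.mem_ker, map_mul, map_inv, hπs (π g) (hπ0 g), mul_inv_cancel]
end

section
/- For every field K and every n ≥ 1, the Heisenberg group H_n(K) of dimension 2n+1 over K is not strongly verbally closed. -/
universe u

open Matrix

/-- The Heisenberg group `H_n(K)` of dimension `2n+1` over a field `K`: upper
unitriangular `(n+2)×(n+2)` matrices `T(ā, b̄, c)` with first row `(1, ā, c)`, middle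
block `Iₙ` with last column `b̄`, and last row `(0,…,0,1)`; here recorded by the data
`(ā, b̄, c)` with the induced matrix multiplication. -/
@[ext] structure Heis (K : Type*) [Field K] (n : ℕ) where
  a : Fin n → K
  b : Fin n → K
  c : K

namespace Heis

variable {K : Type*} [Field K] {n : ℕ}

instance : Mul (Heis K n) :=
  ⟨fun g h => ⟨g.a + h.a, g.b + h.b, g.c + h.c + g.a ⬝ᵥ h.b⟩⟩
instance : One (Heis K n) := ⟨⟨0, 0, 0⟩⟩
instance : Inv (Heis K n) := ⟨fun g => ⟨-g.a, -g.b, -g.c + g.a ⬝ᵥ g.b⟩⟩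

@[simp] lemma mul_a (g h : Heis K n) : (g * h).a = g.a + h.a := rfl
@[simp] lemma mul_b (g h : Heis K n) : (g * h).b = g.b + h.b := rfl
@[simp] lemma mul_c (g h : Heis K n) : (g * h).c = g.c + h.c + g.a ⬝ᵥ h.b := rfl
@[simp] lemma one_a : (1 : Heis K n).a = 0 := rfl
@[simp] lemma one_b : (1 : Heis K n).b = 0 := rfl
@[simp] lemma one_c : (1 : Heis K n).c = 0 := rfl
@[simp] lemma inv_a (g : Heis K n) : (g⁻¹).a = -g.a := rfl
@[simp] lemma inv_b (g : Heis K n) : (g⁻¹).b = -g.b := rfl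
@[simp] lemma inv_c (g : Heis K n) : (g⁻¹).c = -g.c + g.a ⬝ᵥ g.b := rfl

instance : Group (Heis K n) where
  mul_assoc x y z := by
    ext <;> simp [add_dotProduct, dotProduct_add, add_assoc] <;> ring
  one_mul x := by ext <;> simp
  mul_one x := by ext <;> simp
  inv_mul_cancel x := by ext <;> simp [neg_dotProduct]

end Heis

namespace Heis

open scoped commutatorElement

variable {K : Type*} [Field K] {n : ℕ}

/-- The values of a group word on Heisenberg groups over `K` of all dimensions are given by one
linear form (with coefficients `m`) and one bilinear form (with coefficients `β`). -/
lemma exists_lift_coeffs (K : Type*) [Field K] {ι : Type*} [Fintype ι] [DecidableEq ι]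
    (w : FreeGroup ι) :
    ∃ (m : ι → K) (β : ι → ι → K), ∀ (n : ℕ) (f : ι → Heis K n),
      (FreeGroup.lift f w).a = ∑ i, m i • (f i).a ∧
      (FreeGroup.lift f w).b = ∑ i, m i • (f i).b ∧
      (FreeGroup.lift f w).c =
        ∑ i, m i * (f i).c + ∑ i, ∑ j, β i j * ((f i).a ⬝ᵥ (f j).b) := by
  induction w using FreeGroup.induction_on with
  | C1 => exact ⟨0, 0, fun n f => by simp⟩
  | of i =>
    refine ⟨Pi.single i 1, 0, fun n f => ?_⟩
    simp [Pi.single_apply, ite_smul, ite_mul]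
  | inv_of i _ =>
    refine ⟨Pi.single i (-1), Pi.single i (Pi.single i 1), fun n f => ?_⟩
    have h (j k : ι) : (Pi.single i (Pi.single i 1) : ι → ι → K) j k =
        if j = i then (if k = i then 1 else 0) else 0 := by
      by_cases hj : j = i
      · subst hj; simp [Pi.single_apply]
      · simp [hj]
    simp only [h]
    simp [Pi.single_apply, ite_smul, ite_mul]
  | mul x y hx hy =>
    obtain ⟨m, β, h⟩ := hx
    obtain ⟨m', β', h'⟩ := hy
    refine ⟨m + m', fun i j => β i j + β' i j + m i * m' j, fun n f => ?_⟩
    obtain ⟨ha, hb, hc⟩ := h n f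
    obtain ⟨ha', hb', hc'⟩ := h' n f
    refine ⟨?_, ?_, ?_⟩
    · simp [ha, ha', add_smul, Finset.sum_add_distrib]
    · simp [hb, hb', add_smul, Finset.sum_add_distrib]
    · simp only [map_mul, mul_c, hc, hc', ha, hb', sum_dotProduct, dotProduct_sum, smul_dotProduct,
        dotProduct_smul, smul_eq_mul, Pi.add_apply, add_mul, Finset.sum_add_distrib, mul_assoc]
      simp only [Finset.mul_sum]
      rw [Finset.sum_comm (f := fun i j => m' i * _)]
      simp only [mul_left_comm (m' _)]
      ring

/-- The embedding of Heisenberg groups that puts a zero in front of both vectors. -/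
def consZero : Heis K n →* Heis K (n + 1) where
  toFun g := ⟨vecCons 0 g.a, vecCons 0 g.b, g.c⟩
  map_one' := by ext i <;> simp
  map_mul' g h := Heis.ext (by simp) (by simp) (by simp)

@[simp] lemma consZero_a (g : Heis K n) : (consZero g).a = vecCons 0 g.a := rfl
@[simp] lemma consZero_b (g : Heis K n) : (consZero g).b = vecCons 0 g.b := rfl
@[simp] lemma consZero_c (g : Heis K n) : (consZero g).c = g.c := rfl

lemma consZero_injective : Function.Injective (consZero : Heis K n →* Heis K (n + 1)) := by
  intro g h hgh
  have ha : vecCons 0 g.a = vecCons 0 h.a := congrArg Heis.a hgh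
  have hb : vecCons 0 g.b = vecCons 0 h.b := congrArg Heis.b hgh
  exact Heis.ext (vecCons_inj.1 ha).2 (vecCons_inj.1 hb).2 (congrArg (fun x => x.c) hgh)

lemma exists_lift_eq_of_lift_eq_consZero (hn : 1 ≤ n) {ι : Type*} [Fintype ι] [DecidableEq ι]
    (w : FreeGroup ι) (h : Heis K n) (f : ι → Heis K (n + 1))
    (hf : FreeGroup.lift f w = consZero h) : ∃ g : ι → Heis K n, FreeGroup.lift g w = h := by
  obtain ⟨m, β, hw⟩ := exists_lift_coeffs K w
  by_cases hm : ∃ i, m i ≠ 0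
  · obtain ⟨i, hi⟩ := hm
    let x : Heis K n := ⟨(m i)⁻¹ • h.a, (m i)⁻¹ • h.b,
      (m i)⁻¹ * (h.c - β i i * (((m i)⁻¹ • h.a) ⬝ᵥ ((m i)⁻¹ • h.b)))⟩
    refine ⟨Pi.mulSingle i x, ?_⟩
    have hne (j : ι) (hj : j ≠ i) : (Pi.mulSingle i x : ι → Heis K n) j = 1 := by
      simp [hj]
    obtain ⟨ha, hb, hc⟩ := hw n (Pi.mulSingle i x)
    rw [Finset.sum_eq_single i (fun j _ hj => by simp [hne j hj]) (by simp)] at ha hb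
    rw [Finset.sum_eq_single i (fun j _ hj => by simp [hne j hj]) (by simp),
      Finset.sum_eq_single i (fun j _ hj => by simp [hne j hj]) (by simp),
      Finset.sum_eq_single i (fun j _ hj => by simp [hne j hj]) (by simp)] at hc
    rw [Pi.mulSingle_eq_same] at ha hb hc
    refine Heis.ext ?_ ?_ ?_
    · rw [ha, smul_inv_smul₀ hi]
    · rw [hb, smul_inv_smul₀ hi]
    · rw [hc, mul_inv_cancel_left₀ hi, sub_add_cancel]
  · push Not at hm
    obtain ⟨ha, hb, hc⟩ := hw (n + 1) f
    simp only [hf, hm, zero_smul, zero_mul, Finset.sum_const_zero, zero_add, consZero_a,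
      consZero_b, consZero_c] at ha hb hc
    have ha0 : h.a = 0 := funext fun k => by simpa using congrFun ha k.succ
    have hb0 : h.b = 0 := funext fun k => by simpa using congrFun hb k.succ
    by_cases hβ : ∃ i j, β i j ≠ 0
    · obtain ⟨i, j, hij⟩ := hβ
      let e : Fin n → K := Pi.single ⟨0, hn⟩ 1
      let g : ι → Heis K n := fun k =>
        ⟨if k = i then ((β i j)⁻¹ * h.c) • e else 0, if k = j then e else 0, 0⟩
      obtain ⟨ga, gb, gc⟩ := hw n g
      refine ⟨g, Heis.ext (by simp [ga, ha0, hm]) (by simp [gb, hb0, hm]) ?_⟩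
      simp only [hm, zero_mul, Finset.sum_const_zero, zero_add] at gc
      rw [gc, Finset.sum_eq_single i (by simp +contextual [g]) (by simp),
        Finset.sum_eq_single j (by simp +contextual [g]) (by simp)]
      simp [g, e, hij]
    · push Not at hβ
      refine ⟨1, ?_⟩
      obtain ⟨ga, gb, gc⟩ := hw n 1
      exact Heis.ext (by simp [ga, ha0]) (by simp [gb, hb0]) (by simp [gc, hc, hβ])

lemma isVerballyClosed_range_consZero (hn : 1 ≤ n) :
    (consZero : Heis K n →* Heis K (n + 1)).range.IsVerballyClosed := by
  rintro k w _ ⟨h, rfl⟩ ⟨f, hf⟩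
  obtain ⟨g, rfl⟩ := exists_lift_eq_of_lift_eq_consZero hn w h f hf
  refine ⟨fun i => consZero (g i), fun i => ⟨g i, rfl⟩, ?_⟩
  exact (DFunLike.congr_fun (FreeGroup.ext_hom (f := FreeGroup.lift fun i => consZero (g i))
    (g := consZero.comp (FreeGroup.lift g)) (by simp)) w)

lemma commutator_eq (g h : Heis K n) :
    ⁅g, h⁆ = ⟨0, 0, g.a ⬝ᵥ h.b - h.a ⬝ᵥ g.b⟩ := by
  rw [commutatorElement_def]
  ext <;> simp [add_dotProduct]
  ring

/-- The standard generators of the Heisenberg group modulo its centre. -/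
def gen (K : Type*) [Field K] {n : ℕ} : Fin n ⊕ Fin n → Heis K n
  | .inl i => ⟨Pi.single i 1, 0, 0⟩
  | .inr i => ⟨0, Pi.single i 1, 0⟩

lemma a_eq_zero_and_b_eq_zero_of_commutator_gen {g : Heis K n}
    (hg : ∀ s, ⁅g, (gen K s : Heis K n)⁆ = 1) : g.a = 0 ∧ g.b = 0 := by
  simp only [commutator_eq] at hg
  refine ⟨funext fun i => ?_, funext fun i => ?_⟩
  · simpa [gen] using congrArg Heis.c (hg (.inr i))
  · simpa [gen] using congrArg Heis.c (hg (.inl i))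

/-- The left-hand sides of the system `[x, s] = 1`, with `s` running over the standard generators,
and `[x, y] = (0, 0, 1)`, with coefficients mapped to a group `A`. -/
def separatingSystem {A : Type*} [Group A] (φ : Heis K n →* A) (x y : A) :
    Option (Fin n ⊕ Fin n) → A
  | none => ⁅x, y⁆ * (φ ⟨0, 0, 1⟩)⁻¹
  | some s => ⁅x, φ (gen K s)⁆

lemma map_separatingSystem {A B : Type*} [Group A] [Group B] (φ : Heis K n →* A) (ψ : A →* B)
    (x y : A) (s : Option (Fin n ⊕ Fin n)) :
    ψ (separatingSystem φ x y s) = separatingSystem (ψ.comp φ) (ψ x) (ψ y) s := by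
  cases s <;> simp [separatingSystem, map_commutatorElement]

lemma not_forall_separatingSystem_id (p q : Heis K n) :
    ¬ ∀ s, separatingSystem (MonoidHom.id (Heis K n)) p q s = 1 := by
  intro H
  obtain ⟨ha, hb⟩ := a_eq_zero_and_b_eq_zero_of_commutator_gen fun s => H (some s)
  have hpq : ⁅p, q⁆ = ⟨0, 0, 1⟩ := mul_inv_eq_one.1 (H none)
  simp [commutator_eq, ha, hb] at hpq

lemma separatingSystem_consZero (s : Option (Fin n ⊕ Fin n)) :
    separatingSystem (consZero : Heis K n →* Heis K (n + 1)) ⟨vecCons 1 0, 0, 0⟩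
      ⟨0, vecCons 1 0, 0⟩ s = 1 := by
  rcases s with _ | s | s <;> simp only [separatingSystem, commutator_eq, gen] <;>
    refine Heis.ext ?_ ?_ ?_ <;> simp

lemma not_isAlgebraicallyClosedIn_range_consZero :
    ¬ (consZero : Heis K n →* Heis K (n + 1)).range.IsAlgebraicallyClosedIn := by
  intro H
  let φ := (consZero : Heis K n →* Heis K (n + 1)).rangeRestrict
  let e := Fintype.equivFin (Option (Fin n ⊕ Fin n))
  obtain ⟨f, hf⟩ := H 2 _ (fun i => separatingSystem (Monoid.Coprod.inl.comp φ)
    (Monoid.Coprod.inr (FreeGroup.of 0)) (Monoid.Coprod.inr (FreeGroup.of 1)) (e.symm i))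
    ⟨![⟨vecCons 1 0, 0, 0⟩, ⟨0, vecCons 1 0, 0⟩], fun i => by
      rw [map_separatingSystem, ← MonoidHom.comp_assoc, Monoid.Coprod.lift_comp_inl,
        Monoid.Coprod.lift_apply_inr, Monoid.Coprod.lift_apply_inr, FreeGroup.lift_apply_of,
        FreeGroup.lift_apply_of]
      exact separatingSystem_consZero _⟩
  obtain ⟨p, hp⟩ := consZero.rangeRestrict_surjective (f 0)
  obtain ⟨q, hq⟩ := consZero.rangeRestrict_surjective (f 1)
  refine not_forall_separatingSystem_id p q fun s =>
    (MonoidHom.rangeRestrict_injective_iff.2 consZero_injective : Function.Injective φ) ?_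
  have hs := hf (e s)
  rw [map_separatingSystem, ← MonoidHom.comp_assoc, Monoid.Coprod.lift_comp_inl,
    Monoid.Coprod.lift_apply_inr, Monoid.Coprod.lift_apply_inr, FreeGroup.lift_apply_of,
    FreeGroup.lift_apply_of, e.symm_apply_apply, ← hp, ← hq] at hs
  rw [map_separatingSystem, map_one]
  exact hs

end Heis

/-- Proposition (§4): for every field `K` and every `n ≥ 1`, the Heisenberg group
`H_n(K)` of dimension `2n+1` over `K` is not strongly verbally closed. -/
theorem heis_not_strongly_verbally_closed (K : Type u) [Field K] (n : ℕ) (hn : 1 ≤ n) :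
    ¬ IsStronglyVerballyClosed (Heis K n) := fun h =>
  Heis.not_isAlgebraicallyClosedIn_range_consZero <|
    h (Heis K (n + 1)) Heis.consZero Heis.consZero_injective
      (Heis.isVerballyClosed_range_consZero hn)
end

section
/- Let K be a field, n ≥ 1, H = H_n(K), and let w be an element of the free group F(x_1,…,x_s). Then the image of the verbal map φ : H^s → H, φ(g_1,…,g_s) = w(g_1,…,g_s), is equal (as a set) to one of the following: the trivial subgroup {1}, the commutator subgroup H' = {T(0, 0, c) : c ∈ K}, or the whole group H. -/
open Matrix

namespace Heis

variable {K : Type*} [Field K] {n : ℕ} {ι : Type*} [Fintype ι]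

lemma sum_smul_dotProduct_sum_smul (e e' : ι → K) (a b : ι → Fin n → K) :
    (∑ i, e i • a i) ⬝ᵥ (∑ j, e' j • b j) = ∑ i, ∑ j, e i * e' j * (a i ⬝ᵥ b j) := by
  simp only [sum_dotProduct _ _ (∑ j, e' j • b j), dotProduct_sum, smul_dotProduct,
    dotProduct_smul, smul_eq_mul, mul_assoc, mul_left_comm]

/-- A verbal map on `Heis K n` is linear modulo the centre, and its central coordinate is linear
in the central coordinates of the arguments up to a combination of the products `aᵢ ⬝ᵥ bⱼ`. -/
lemma exists_lift_eq (w : FreeGroup ι) :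
    ∃ (e : ι → K) (m : ι → ι → K), ∀ f : ι → Heis K n,
      FreeGroup.lift f w = ⟨∑ i, e i • (f i).a, ∑ i, e i • (f i).b,
        ∑ i, e i * (f i).c + ∑ i, ∑ j, m i j * ((f i).a ⬝ᵥ (f j).b)⟩ := by
  classical
  induction w using FreeGroup.induction_on with
  | C1 => exact ⟨0, 0, fun f => by ext <;> simp⟩
  | of x => exact ⟨Pi.single x 1, 0, fun f => by ext <;> simp [Pi.single_apply, ite_apply]⟩
  | inv_of x ih =>
    obtain ⟨e, m, h⟩ := ih
    refine ⟨-e, fun i j => -m i j + e i * e j, fun f => ?_⟩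
    rw [map_inv, h]
    ext
    · simp
    · simp
    · simp only [inv_c, sum_smul_dotProduct_sum_smul, Pi.neg_apply, add_mul, neg_mul,
        Finset.sum_add_distrib, Finset.sum_neg_distrib]
      ring
  | mul x y ihx ihy =>
    obtain ⟨e, m, h⟩ := ihx
    obtain ⟨e', m', h'⟩ := ihy
    refine ⟨e + e', fun i j => m i j + m' i j + e i * e' j, fun f => ?_⟩
    rw [map_mul, h, h']
    ext
    · simp [add_mul, Finset.sum_add_distrib]
    · simp [add_mul, Finset.sum_add_distrib]
    · simp only [mul_c, sum_smul_dotProduct_sum_smul, Pi.add_apply, add_mul,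
        Finset.sum_add_distrib]
      ring

end Heis

/-- Lemma (§4): the image of any verbal map `φ : H_n(K)^s → H_n(K)`,
`φ(g₁,…,g_s) = w(g₁,…,g_s)`, is the trivial subgroup, the commutator subgroup
`H' = {T(0,0,c) : c ∈ K}`, or the whole group. -/
theorem heis_verbal_image_trichotomy (K : Type*) [Field K] (n : ℕ) (hn : 1 ≤ n)
    (s : ℕ) (w : FreeGroup (Fin s)) :
    (Set.range fun f : Fin s → Heis K n => FreeGroup.lift f w) = {1} ∨
    (Set.range fun f : Fin s → Heis K n => FreeGroup.lift f w) =
      {g : Heis K n | g.a = 0 ∧ g.b = 0} ∨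
    (Set.range fun f : Fin s → Heis K n => FreeGroup.lift f w) = Set.univ := by
  obtain ⟨e, m, h⟩ := Heis.exists_lift_eq (K := K) (n := n) w
  by_cases he : e = 0
  · subst he
    by_cases hm : m = 0
    · subst hm
      refine Or.inl (Set.eq_singleton_iff_unique_mem.2 ⟨⟨1, ?_⟩, ?_⟩)
      · ext <;> simp [h]
      · rintro _ ⟨f, rfl⟩
        ext <;> simp [h]
    · refine Or.inr (Or.inl (Set.Subset.antisymm ?_ ?_))
      · rintro _ ⟨f, rfl⟩
        simp [h]
      · rintro ⟨a, b, c⟩ ⟨rfl, rfl⟩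
        obtain ⟨i, hi⟩ := Function.ne_iff.1 hm
        obtain ⟨j, hj⟩ := Function.ne_iff.1 hi
        have hij : m i j ≠ 0 := hj
        let k : Fin n := ⟨0, hn⟩
        refine ⟨fun l => ⟨Pi.single k (if l = i then c / m i j else 0),
          Pi.single k (if l = j then 1 else 0), 0⟩, ?_⟩
        ext <;> simp [h, mul_div_cancel₀, hij]
  · obtain ⟨i, hi⟩ := Function.ne_iff.1 he
    have hei : e i ≠ 0 := hi
    refine Or.inr (Or.inr (Set.eq_univ_of_forall fun ⟨a, b, c⟩ => ?_))
    refine ⟨fun l => ⟨if l = i then (e i)⁻¹ • a else 0, if l = i then (e i)⁻¹ • b else 0,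
      if l = i then (e i)⁻¹ * (c - m i i * (((e i)⁻¹ • a) ⬝ᵥ ((e i)⁻¹ • b))) else 0⟩, ?_⟩
    have hdot (l l' : Fin s) : (if l = i then (e i)⁻¹ • a else 0) ⬝ᵥ
        (if l' = i then (e i)⁻¹ • b else 0) =
        if l = i then if l' = i then ((e i)⁻¹ • a) ⬝ᵥ ((e i)⁻¹ • b) else 0 else 0 := by
      split_ifs <;> simp
    ext
    · simp [h, hei]
    · simp [h, hei]
    · simp only [h, hdot, mul_ite, mul_zero, Finset.sum_ite_eq', Finset.mem_univ, if_true,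
        Finset.sum_ite_irrel, Finset.sum_const_zero, mul_inv_cancel_left₀ hei, sub_add_cancel]
end

section
/- Let G be a nonabelian group whose commutator subgroup G' is contained in its center Z(G), and let K = (G × G̃)/{(c, c⁻¹) : c ∈ G'} be the central product of G with a copy G̃ of itself with joined commutator subgroup. Then the natural embedding of G into K (induced by g ↦ (g, 1)) is not a retract of K: there is no homomorphism ρ : K → G restricting to the identity on the image of G. -/
universe u

open scoped commutatorElement

/-- A homomorphism `f : G × H →* G` fixing the first factor sends the second factor
into the center of `G`. -/
theorem map_one_prod_mem_center {G H : Type*} [Group G] [Group H] (f : G × H →* G)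
    (hf : ∀ g, f (g, 1) = g) (h : H) : f (1, h) ∈ Subgroup.center G := by
  rw [Subgroup.mem_center_iff]
  intro g
  calc g * f (1, h) = f ((g, 1) * (1, h)) := by rw [map_mul, hf]
    _ = f ((1, h) * (g, 1)) := by simp
    _ = f (1, h) * g := by rw [map_mul, hf]

/-- A homomorphism `f : G × H →* G` fixing the first factor kills commutators of the
second factor. -/
theorem map_one_prod_commutatorElement {G H : Type*} [Group G] [Group H] (f : G × H →* G)
    (hf : ∀ g, f (g, 1) = g) (a b : H) : f (1, ⁅a, b⁆) = 1 := by
  have key : f.comp (MonoidHom.inr G H) ⁅a, b⁆ = 1 := by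
    rw [map_commutatorElement, commutatorElement_eq_one_iff_mul_comm]
    exact Subgroup.mem_center_iff.mp (map_one_prod_mem_center f hf b) _
  exact key

/-- Proposition (§4, key step): let `G` be a nonabelian group with `G' ≤ Z(G)`, and let
`K = (G × G̃)/{(c, c⁻¹) : c ∈ G'}` be the central product of `G` with a copy of itself
with joined commutator subgroup. Then the natural embedding `g ↦ (g, 1)` of `G` into `K`
admits no retraction: there is no homomorphism `ρ : K → G` with `ρ((g,1) mod ·) = g`. -/
theorem no_retraction_central_product (G : Type u) [Group G]
    (hnab : ∃ a b : G, a * b ≠ b * a)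
    (hcen : commutator G ≤ Subgroup.center G) :
    ¬ ∃ ρ : (G × G) ⧸ Subgroup.normalClosure
          {x : G × G | ∃ c ∈ commutator G, x = (c, c⁻¹)} →* G,
        ∀ g : G, ρ (QuotientGroup.mk (g, 1)) = g := by
  rintro ⟨ρ, hρ⟩
  obtain ⟨a, b, hab⟩ := hnab
  let f : G × G →* G := ρ.comp (QuotientGroup.mk' _)
  have hf : ∀ g, f (g, 1) = g := hρ
  have hmem : ⁅b, a⁆ ∈ commutator G :=
    Subgroup.commutator_mem_commutator (Subgroup.mem_top b) (Subgroup.mem_top a)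
  have hker : f (⁅b, a⁆, ⁅b, a⁆⁻¹) = 1 := by
    have hmk := (QuotientGroup.eq_one_iff _).mpr (Subgroup.subset_normalClosure
      (show (⁅b, a⁆, ⁅b, a⁆⁻¹) ∈ {x : G × G | ∃ c ∈ commutator G, x = (c, c⁻¹)} from
        ⟨_, hmem, rfl⟩))
    exact (congrArg ρ hmk).trans (map_one ρ)
  have hsplit : ((⁅b, a⁆, ⁅b, a⁆⁻¹) : G × G) = (⁅b, a⁆, 1) * (1, ⁅a, b⁆) := by simp
  rw [hsplit, map_mul, hf, map_one_prod_commutatorElement f hf, mul_one,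
    commutatorElement_eq_one_iff_mul_comm] at hker
  exact hab hker.symm
end

section
/- Let p be a prime and k ≥ 1. Let G be an abelian group isomorphic to a direct sum of (possibly infinitely many) copies of ℤ/p^kℤ, and let H be an abelian group of exponent dividing p^k containing G as a subgroup. Then G is a direct summand of H: there exists a subgroup X ≤ H with G ∩ X = {0} and G + X = H. -/
universe u

theorem ZMod.dvd_of_forall_mul_eq_zero {n : ℕ} [NeZero n] {a b : ZMod n}
    (h : ∀ r : ZMod n, r * a = 0 → r * b = 0) : a ∣ b := by
  obtain ⟨m, hm⟩ := Nat.gcd_dvd_right a.val n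
  obtain ⟨c, hc⟩ := Nat.gcd_dvd_left a.val n
  have hab : a ∣ ((a.val.gcd n : ℕ) : ZMod n) := by
    have := congrArg (Int.cast : ℤ → ZMod n) (Nat.gcd_eq_gcd_ab a.val n)
    push_cast at this
    rw [ZMod.natCast_self, ZMod.natCast_rightInverse a, zero_mul, add_zero] at this
    exact Dvd.intro _ this.symm
  have hma : (m : ZMod n) * a = 0 := by
    rw [← ZMod.natCast_rightInverse a, ← Nat.cast_mul, ZMod.natCast_eq_zero_iff]
    exact ⟨c, by nth_rewrite 1 [hc]; nth_rewrite 3 [hm]; ring⟩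
  have hmb := h m hma
  rw [← ZMod.natCast_rightInverse b, ← Nat.cast_mul, ZMod.natCast_eq_zero_iff] at hmb
  have hm0 : 0 < m := Nat.pos_of_ne_zero fun h0 => NeZero.ne n (by rw [hm, h0, mul_zero])
  have hdb : a.val.gcd n ∣ b.val := by
    refine Nat.dvd_of_mul_dvd_mul_left hm0 ?_
    rwa [mul_comm m (a.val.gcd n), ← hm]
  rw [← ZMod.natCast_rightInverse b]
  exact hab.trans (Nat.cast_dvd_cast hdb)

theorem ZMod.baer_finsupp (n : ℕ) [NeZero n] (ι : Type*) :
    Module.Baer (ZMod n) (ι →₀ ZMod n) := by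
  have : IsPrincipalIdealRing (ZMod n) :=
    IsPrincipalIdealRing.of_surjective (Int.castRingHom (ZMod n)) ZMod.intCast_surjective
  intro I g
  obtain ⟨a, rfl⟩ := (IsPrincipalIdealRing.principal I).principal
  have ha : a ∈ Submodule.span (ZMod n) {a} := Submodule.mem_span_singleton_self a
  set q := g ⟨a, ha⟩ with hq
  have hdvd (i : ι) : a ∣ q i := ZMod.dvd_of_forall_mul_eq_zero fun r hr => by
    have : r • q = 0 := by
      rw [hq, ← map_smul, ← map_zero g]
      exact congrArg g (Subtype.ext hr)
    simpa using DFunLike.congr_fun this i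
  choose c hc using hdvd
  refine ⟨LinearMap.toSpanSingleton _ _ (Finsupp.onFinset q.support
    (fun i => if q i = 0 then 0 else c i) fun i hi => by aesop), fun x hx => ?_⟩
  obtain ⟨r, rfl⟩ := Submodule.mem_span_singleton.mp hx
  have : g ⟨r • a, hx⟩ = r • q := by rw [hq, ← map_smul]; rfl
  rw [this]
  ext i
  by_cases hi : q i = 0
  · simp [hi]
  · simp [hi, mul_assoc, ← hc i]

/-- Key step of Proposition 2: let `p` be a prime and `k ≥ 1`. If `G` is a subgroup of
an abelian group `H` of exponent dividing `p^k`, and `G` is isomorphic to a direct sum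
of copies of `ℤ/p^kℤ`, then `G` is a direct summand of `H`. -/
theorem direct_summand_of_homocyclic (p : ℕ) (hp : p.Prime) (k : ℕ) (hk : 1 ≤ k)
    (H : Type u) [AddCommGroup H] (hH : ∀ h : H, (p ^ k) • h = 0)
    (G : AddSubgroup H)
    (hG : ∃ I : Type u, Nonempty (G ≃+ (I →₀ ZMod (p ^ k)))) :
    ∃ X : AddSubgroup H, G ⊓ X = ⊥ ∧
      ∀ h : H, ∃ g ∈ G, ∃ x ∈ X, h = g + x := by
  obtain ⟨I, ⟨e⟩⟩ := hG
  have : NeZero (p ^ k) := ⟨pow_ne_zero k hp.ne_zero⟩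
  obtain ⟨f, hfe⟩ : ∃ f : H →+ (I →₀ ZMod (p ^ k)), ∀ g : G, f g = e g := by
    let : Module (ZMod (p ^ k)) H := AddCommGroup.zmodModule hH
    let : Module (ZMod (p ^ k)) G := AddCommGroup.zmodModule fun g => Subtype.ext (hH g)
    obtain ⟨f, hf⟩ := (ZMod.baer_finsupp (p ^ k) I).extension_property
      (G.subtype.toZModLinearMap (p ^ k)) Subtype.val_injective
      (e.toAddMonoidHom.toZModLinearMap (p ^ k))
    exact ⟨f.toAddMonoidHom, fun g => LinearMap.congr_fun hf g⟩
  refine ⟨f.ker, (AddSubgroup.eq_bot_iff_forall _).mpr ?_, fun h => ?_⟩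
  · rintro x ⟨hxG, hx⟩
    have hex : e ⟨x, hxG⟩ = 0 := (hfe ⟨x, hxG⟩).symm.trans hx
    exact congrArg Subtype.val (e.map_eq_zero_iff.mp hex)
  · refine ⟨e.symm (f h), (e.symm (f h)).2, h - e.symm (f h), ?_, by abel⟩
    change f (h - e.symm (f h)) = 0
    rw [map_sub, hfe, e.apply_symm_apply, sub_self]
end
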